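/- Let F ∈ ℤ[x,y] have total degree 4 with F(0,0) = 0, and suppose F is linked. For each irreducible primitive integral binary form H dividing gcd(F̃_4, F_3), let n_4(H) and n_3(H) be the largest integers such that H^{n_4(H)} divides F̃_4 and H^{n_3(H)} divides F_3, respectively. If n_3(H) ≠ n_4(H)/2 for every such H, then for every positive integer C and every integer D, F(ℤ²) ≠ (Cℤ)_{≥D} = {Cn : n ∈ ℤ, Cn ≥ D}. -/

import Mathlib

open MvPolynomial

/-- Evaluation of an integer polynomial in two variables at a real point. -/
noncomputable def evalReal (G : MvPolynomial (Fin 2) ℤ) (x y : ℝ) : ℝ :=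
  MvPolynomial.aeval ![x, y] G

/-- An integral binary form (or polynomial) is positive semi-definite if it is
nonnegative at every real point. -/
def PosSemidef2 (G : MvPolynomial (Fin 2) ℤ) : Prop :=
  ∀ x y : ℝ, 0 ≤ evalReal G x y

/-- Positive definite: positive at every nonzero real point. -/
def PosDef2 (G : MvPolynomial (Fin 2) ℤ) : Prop :=
  ∀ x y : ℝ, (x, y) ≠ (0, 0) → 0 < evalReal G x y

/-- A primitive integral polynomial: the gcd of its coefficients is a unit. -/
def IsPrimitiveInt (G : MvPolynomial (Fin 2) ℤ) : Prop :=
  ∀ d : ℤ, (∀ m, d ∣ MvPolynomial.coeff m G) → IsUnit d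

/-- The image of an integral polynomial in `ℚ[x,y]`. -/
noncomputable def toQ (G : MvPolynomial (Fin 2) ℤ) : MvPolynomial (Fin 2) ℚ :=
  MvPolynomial.map (Int.castRingHom ℚ) G

/-- `Ft4` is the polynomial `F̃₄ = F₄ / P₀`, where `P₀` is the positive definite integral
form of largest degree (possibly a positive constant) dividing `F₄` such that the quotient
is a primitive integral form. -/
def IsTildePart (F4 Ft4 : MvPolynomial (Fin 2) ℤ) : Prop :=
  ∃ (P0 : MvPolynomial (Fin 2) ℤ) (k : ℕ),
    P0.IsHomogeneous k ∧ PosDef2 P0 ∧ F4 = P0 * Ft4 ∧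
    (∃ n, Ft4.IsHomogeneous n) ∧ IsPrimitiveInt Ft4 ∧
    (∀ (P0' Ft4' : MvPolynomial (Fin 2) ℤ) (k' : ℕ),
      P0'.IsHomogeneous k' → PosDef2 P0' → F4 = P0' * Ft4' →
      (∃ n, Ft4'.IsHomogeneous n) → IsPrimitiveInt Ft4' → k' ≤ k)

/-- Two integral polynomials have a common non-constant factor over `ℚ`
(i.e. their gcd in `ℚ[x,y]` is not 1). -/
def CommonFactor2 (A B : MvPolynomial (Fin 2) ℤ) : Prop :=
  ∃ d : MvPolynomial (Fin 2) ℚ, 0 < d.totalDegree ∧ d ∣ toQ A ∧ d ∣ toQ B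

/-- Three integral polynomials have a common non-constant factor over `ℚ`. -/
def CommonFactor3 (A B C : MvPolynomial (Fin 2) ℤ) : Prop :=
  ∃ d : MvPolynomial (Fin 2) ℚ, 0 < d.totalDegree ∧ d ∣ toQ A ∧ d ∣ toQ B ∧ d ∣ toQ C

/-- Four integral polynomials have a common non-constant factor over `ℚ`. -/
def CommonFactor4 (A B C D : MvPolynomial (Fin 2) ℤ) : Prop :=
  ∃ d : MvPolynomial (Fin 2) ℚ, 0 < d.totalDegree ∧
    d ∣ toQ A ∧ d ∣ toQ B ∧ d ∣ toQ C ∧ d ∣ toQ D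

/-- The value set `F(ℤ²)`. -/
def valueSet (F : MvPolynomial (Fin 2) ℤ) : Set ℤ :=
  {m : ℤ | ∃ x y : ℤ, MvPolynomial.eval ![x, y] F = m}

/-- The set `(Cℤ)_{≥ D} = {Cn : n ∈ ℤ, Cn ≥ D}`. -/
def targetSet (C D : ℤ) : Set ℤ :=
  {m : ℤ | (∃ n : ℤ, m = C * n) ∧ D ≤ m}

/-- `F` is linked: `F₄` is positive semi-definite, `gcd(F̃₄, F₃) ≠ 1`
and `gcd(F̃₄, F₃, F₂) = 1`. -/
def Linked (F : MvPolynomial (Fin 2) ℤ) : Prop :=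
  PosSemidef2 (MvPolynomial.homogeneousComponent 4 F) ∧
  ∃ Ft4 : MvPolynomial (Fin 2) ℤ,
    IsTildePart (MvPolynomial.homogeneousComponent 4 F) Ft4 ∧
    CommonFactor2 Ft4 (MvPolynomial.homogeneousComponent 3 F) ∧
    ¬ CommonFactor3 Ft4 (MvPolynomial.homogeneousComponent 3 F)
        (MvPolynomial.homogeneousComponent 2 F)


lemma strip_aux (β : ℝ) (A T : ℕ) (S : Finset (ℤ × ℤ))
    (hS : ∀ p ∈ S, |p.2| ≤ (A * T ^ 2 : ℤ) ∧ |(p.1 : ℝ) + β * p.2| ≤ A * T) :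
    S.card ≤ (2 * (A * T ^ 2) + 1) * (2 * (A * T + 1) + 1) := by
  classical
  have key : S.card ≤ (Finset.Icc (-(A * T ^ 2 : ℤ)) (A * T ^ 2) ×ˢ
      Finset.Icc (-(A * T + 1 : ℤ)) (A * T + 1)).card := by
    apply Finset.card_le_card_of_injOn (fun p => (p.2, p.1 + ⌊β * p.2⌋))
    · intro p hp
      obtain ⟨h1, h2⟩ := hS p hp
      have h1' := abs_le.1 h1
      have h2' := abs_le.1 h2
      have hf1 := Int.floor_le (β * p.2)
      have hf2 := Int.lt_floor_add_one (β * p.2)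
      simp only [Finset.coe_product, Set.mem_prod, Finset.coe_Icc, Set.mem_Icc]
      refine ⟨h1', ?_, ?_⟩
      · have : (-(A * T + 1 : ℤ) : ℝ) ≤ ((p.1 + ⌊β * p.2⌋ : ℤ) : ℝ) := by
          push_cast; linarith
        exact_mod_cast this
      · have : ((p.1 + ⌊β * p.2⌋ : ℤ) : ℝ) ≤ ((A * T + 1 : ℤ) : ℝ) := by
          push_cast; linarith
        exact_mod_cast this
    · rintro ⟨a, b⟩ _ ⟨c, d⟩ _ h
      simp only [Prod.mk.injEq] at h ⊢
      obtain ⟨h1, h2⟩ := h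
      subst h1
      exact ⟨by linarith, rfl⟩
  refine key.trans (le_of_eq ?_)
  rw [Finset.card_product, Int.card_Icc, Int.card_Icc]
  congr 1
  · have : (A * T ^ 2 : ℤ) + 1 - -(A * T ^ 2) = ((2 * (A * T ^ 2) + 1 : ℕ) : ℤ) := by
      push_cast; ring
    rw [this, Int.toNat_natCast]
  · have : (A * T + 1 : ℤ) + 1 - -(A * T + 1) = ((2 * (A * T + 1) + 1 : ℕ) : ℤ) := by
      push_cast; ring
    rw [this, Int.toNat_natCast]

lemma strip_aux2 (A T : ℕ) (hT : 1 ≤ T) :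
    (2 * (A * T ^ 2) + 1) * (2 * (A * T + 1) + 1) ≤ ((2 * A + 1) * (2 * A + 3)) * T ^ 3 := by
  have h1 : 2 * (A * T ^ 2) + 1 ≤ (2 * A + 1) * T ^ 2 := by nlinarith [Nat.one_le_pow 2 T hT]
  have h2 : 2 * (A * T + 1) + 1 ≤ (2 * A + 3) * T := by nlinarith
  calc _ ≤ ((2 * A + 1) * T ^ 2) * ((2 * A + 3) * T) := Nat.mul_le_mul h1 h2
    _ = _ := by ring

lemma strip_count (α β : ℝ) (h : α ≠ 0 ∨ β ≠ 0) (A : ℕ) :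
    ∃ B : ℕ, ∀ T : ℕ, 1 ≤ T → ∀ S : Finset (ℤ × ℤ),
      (∀ p ∈ S, |p.1| ≤ (A * T ^ 2 : ℤ) ∧ |p.2| ≤ (A * T ^ 2 : ℤ) ∧
        |α * p.1 + β * p.2| ≤ A * T) → S.card ≤ B * T ^ 3 := by
  classical
  wlog hα : α ≠ 0 generalizing α β
  · obtain ⟨B, hB⟩ := this β α h.symm (by tauto)
    refine ⟨B, fun T hT S hS => ?_⟩
    have := hB T hT (S.map (Equiv.prodComm ℤ ℤ).toEmbedding) (by
      intro p hp
      obtain ⟨q, hq, rfl⟩ := Finset.mem_map.1 hp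
      obtain ⟨h1, h2, h3⟩ := hS q hq
      refine ⟨h2, h1, ?_⟩
      simpa [add_comm] using h3)
    simpa using this
  · obtain ⟨A', hA'⟩ := exists_nat_ge (max (A : ℝ) (A / |α|))
    have hA1 : (A : ℝ) ≤ A' := (le_max_left _ _).trans hA'
    have hA2 : (A : ℝ) / |α| ≤ A' := (le_max_right _ _).trans hA'
    have hA1' : A ≤ A' := by exact_mod_cast hA1
    refine ⟨(2 * A' + 1) * (2 * A' + 3), fun T hT S hS => ?_⟩
    refine (strip_aux (β / α) A' T S ?_).trans (strip_aux2 A' T hT)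
    intro p hp
    obtain ⟨h1, h2, h3⟩ := hS p hp
    constructor
    · refine h2.trans ?_
      have : (A : ℤ) ≤ A' := by exact_mod_cast hA1'
      gcongr
    · have hpos : 0 < |α| := abs_pos.2 hα
      have e : (p.1 : ℝ) + β / α * p.2 = (α * p.1 + β * p.2) / α := by field_simp
      rw [e, abs_div, div_le_iff₀ hpos]
      rw [div_le_iff₀ hpos] at hA2
      calc _ ≤ _ := h3
        _ ≤ (A' * |α|) * T := by gcongr
        _ = _ := by ring

set_option maxHeartbeats 1000000 in
lemma count_contra (f : ℤ → ℤ → ℤ) (C D : ℤ) (hC : 0 < C)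
    (hsurj : ∀ n, D ≤ C * n → ∃ x y, f x y = C * n) (δ K α₁ β₁ α₂ β₂ : ℝ) (hδ : 0 < δ)
    (h1 : α₁ ≠ 0 ∨ β₁ ≠ 0) (h2 : α₂ ≠ 0 ∨ β₂ ≠ 0)
    (hb : ∀ x y : ℤ, δ * (((α₁ * x + β₁ * y) * (α₂ * x + β₂ * y)) ^ 2 + x ^ 2 + y ^ 2) - K
      ≤ f x y) : False := by
  classical
  obtain ⟨A, hA⟩ := exists_nat_ge ((C * (|D| + 1) + |K|) / δ + 1)
  rw [← sub_nonneg] at hA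
  have hA1 : (1 : ℝ) ≤ A := by
    have : 0 ≤ ((C : ℝ) * (|D| + 1) + |K|) / δ := by
      have : (0 : ℝ) < C := by exact_mod_cast hC
      positivity
    linarith
  have hA2 : (C : ℝ) * (|D| + 1) + |K| ≤ δ * A := by
    have : ((C : ℝ) * (|D| + 1) + |K|) / δ ≤ A := by linarith
    rw [div_le_iff₀ hδ] at this; linarith
  obtain ⟨B₁, hB₁⟩ := strip_count α₁ β₁ h1 A
  obtain ⟨B₂, hB₂⟩ := strip_count α₂ β₂ h2 A
  set T : ℕ := B₁ + B₂ + 1 with hTdef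
  have hT : 1 ≤ T := by omega
  have hpre : ∀ j : ℕ, ∃ p : ℤ × ℤ, f p.1 p.2 = C * (|D| + j) := by
    intro j
    obtain ⟨x, y, h⟩ := hsurj (|D| + j) (by
      have := le_abs_self D
      have h3 := abs_nonneg D
      nlinarith)
    exact ⟨(x, y), h⟩
  choose g hg using hpre
  have ginj : Function.Injective g := by
    intro i j hij
    have := hg i
    rw [hij, hg j] at this
    have := mul_left_cancel₀ hC.ne' this
    omega
  set S := (Finset.range (T ^ 4)).image g with hS
  have hcard : S.card = T ^ 4 := by
    rw [hS, Finset.card_image_of_injective _ ginj, Finset.card_range]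
  have hTr : (1 : ℝ) ≤ T := by exact_mod_cast hT
  have hT4 : (1 : ℝ) ≤ (T : ℝ) ^ 4 := one_le_pow₀ hTr
  have hSb : ∀ p ∈ S, ((α₁ * p.1 + β₁ * p.2) * (α₂ * p.1 + β₂ * p.2)) ^ 2 + (p.1 : ℝ) ^ 2
      + (p.2 : ℝ) ^ 2 ≤ A * T ^ 4 := by
    intro p hp
    obtain ⟨j, hj, rfl⟩ := Finset.mem_image.1 hp
    have hj' : (j : ℝ) ≤ T ^ 4 := by
      have := (Finset.mem_range.1 hj).le
      exact_mod_cast this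
    have h3 := hb (g j).1 (g j).2
    rw [hg j] at h3
    push_cast at h3
    have hCr : (0 : ℝ) < C := by exact_mod_cast hC
    have h4 : (C : ℝ) * (|(D : ℝ)| + j) + K ≤ (C * (|(D : ℝ)| + 1) + |K|) * T ^ 4 := by
      have e1 : |(D : ℝ)| + j ≤ (|(D : ℝ)| + 1) * T ^ 4 := by
        nlinarith [abs_nonneg (D : ℝ)]
      have e2 : K ≤ |K| * T ^ 4 := by nlinarith [abs_nonneg K, le_abs_self K]
      nlinarith
    have h5 : δ * (((α₁ * (g j).1 + β₁ * (g j).2) * (α₂ * (g j).1 + β₂ * (g j).2)) ^ 2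
      + ((g j).1 : ℝ) ^ 2 + ((g j).2 : ℝ) ^ 2) ≤ δ * (A * T ^ 4) := by
      have : ((C : ℝ) * (|(D : ℝ)| + 1) + |K|) * T ^ 4 ≤ (δ * A) * T ^ 4 := by
        gcongr
        simpa using hA2
      linarith
    exact le_of_mul_le_mul_left h5 hδ
  have hAA : (A : ℝ) * T ^ 4 ≤ (A * T ^ 2) ^ 2 := by
    have : (A : ℝ) ≤ A ^ 2 := by nlinarith
    calc (A : ℝ) * T ^ 4 ≤ A ^ 2 * T ^ 4 := by gcongr
      _ = _ := by ring
  have hx : ∀ p ∈ S, |p.1| ≤ (A * T ^ 2 : ℤ) ∧ |p.2| ≤ (A * T ^ 2 : ℤ) := by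
    intro p hp
    have h3 := hSb p hp
    have s0 := sq_nonneg ((α₁ * p.1 + β₁ * p.2) * (α₂ * p.1 + β₂ * p.2))
    constructor
    · have : |(p.1 : ℝ)| ≤ A * T ^ 2 := by
        apply abs_le_of_sq_le_sq _ (by positivity)
        nlinarith [sq_nonneg (p.2 : ℝ)]
      exact_mod_cast this
    · have : |(p.2 : ℝ)| ≤ A * T ^ 2 := by
        apply abs_le_of_sq_le_sq _ (by positivity)
        nlinarith [sq_nonneg (p.1 : ℝ)]
      exact_mod_cast this
  have hu : ∀ p ∈ S, |α₁ * p.1 + β₁ * p.2| ≤ (A * T : ℝ) ∨ |α₂ * p.1 + β₂ * p.2| ≤ (A * T : ℝ) := by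
    intro p hp
    by_contra! hcon
    have h3 := hSb p hp
    have h4 : ((A * T : ℝ) * (A * T)) ^ 2 < (|α₁ * p.1 + β₁ * p.2| * |α₂ * p.1 + β₂ * p.2|) ^ 2 := by
      have hp0 : (0 : ℝ) < A * T := by positivity
      have := mul_lt_mul'' hcon.1 hcon.2 hp0.le hp0.le
      gcongr
    rw [← abs_mul, sq_abs] at h4
    have h5 : (A : ℝ) * T ^ 4 ≤ ((A * T : ℝ) * (A * T)) ^ 2 := by
      have : (A : ℝ) ≤ A ^ 4 := by
        calc (A : ℝ) = A ^ 1 := by ring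
          _ ≤ A ^ 4 := pow_le_pow_right₀ hA1 (by norm_num)
      calc (A : ℝ) * T ^ 4 ≤ A ^ 4 * T ^ 4 := by gcongr
        _ = _ := by ring
    linarith [sq_nonneg (p.1 : ℝ), sq_nonneg (p.2 : ℝ)]
  have c1 := hB₁ T hT (S.filter (fun p => |α₁ * p.1 + β₁ * p.2| ≤ (A * T : ℝ))) (by
    intro p hp
    rw [Finset.mem_filter] at hp
    exact ⟨(hx p hp.1).1, (hx p hp.1).2, hp.2⟩)
  have c2 := hB₂ T hT (S.filter (fun p => ¬ |α₁ * p.1 + β₁ * p.2| ≤ (A * T : ℝ))) (by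
    intro p hp
    rw [Finset.mem_filter] at hp
    exact ⟨(hx p hp.1).1, (hx p hp.1).2, (hu p hp.1).resolve_left hp.2⟩)
  have c3 := S.card_filter_add_card_filter_not (fun p => |α₁ * p.1 + β₁ * p.2| ≤ (A * T : ℝ))
  rw [hcard] at c3
  have : T ^ 4 ≤ (B₁ + B₂) * T ^ 3 := by linarith
  have h6 : T ^ 4 = (B₁ + B₂) * T ^ 3 + T ^ 3 := by rw [hTdef]; ring
  have : 0 < T ^ 3 := by positivity
  omega

lemma ineq_A (c b d e f g h : ℝ) (hc : 0 < c) (hb : 0 < b) : ∃ δ K : ℝ, 0 < δ ∧ ∀ u w : ℝ,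
    δ * ((u * u) ^ 2 + u ^ 2 + w ^ 2) - K ≤
      c * u ^ 4 + d * u ^ 3 + b * w ^ 2 + e * u * w + f * u ^ 2 + g * u + h * w := by
  set f' := f - e ^ 2 / b - 1 - d ^ 2 / c with hf'
  refine ⟨min (c / 4) (b / 2), h ^ 2 / b + g ^ 2 + f' ^ 2 / c + c / 4, by positivity, fun u w => ?_⟩
  have m1 : min (c / 4) (b / 2) ≤ c / 4 := min_le_left _ _
  have m2 : min (c / 4) (b / 2) ≤ b / 2 := min_le_right _ _
  have m0 : 0 < min (c / 4) (b / 2) := by positivity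
  set δ := min (c / 4) (b / 2)
  have e1 : -(b / 4) * w ^ 2 - (e ^ 2 / b) * u ^ 2 ≤ e * u * w := by
    have : e * u * w + (b / 4) * w ^ 2 + (e ^ 2 / b) * u ^ 2 = (b * w / 2 + e * u) ^ 2 / b := by
      field_simp; ring
    have : 0 ≤ (b * w / 2 + e * u) ^ 2 / b := by positivity
    linarith
  have e2 : -(b / 4) * w ^ 2 - h ^ 2 / b ≤ h * w := by
    have : h * w + (b / 4) * w ^ 2 + h ^ 2 / b = (b * w / 2 + h) ^ 2 / b := by
      field_simp; ring
    have : 0 ≤ (b * w / 2 + h) ^ 2 / b := by positivity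
    linarith
  have e3 : -u ^ 2 - g ^ 2 ≤ g * u := by nlinarith [sq_nonneg (g + u), sq_nonneg g, sq_nonneg u]
  have e4 : -(c / 4) * u ^ 4 - (d ^ 2 / c) * u ^ 2 ≤ d * u ^ 3 := by
    have : d * u ^ 3 + (c / 4) * u ^ 4 + (d ^ 2 / c) * u ^ 2 = (c * u ^ 2 / 2 + d * u) ^ 2 / c := by
      field_simp; ring
    have : 0 ≤ (c * u ^ 2 / 2 + d * u) ^ 2 / c := by positivity
    linarith
  have e5 : -(c / 4) * u ^ 4 - f' ^ 2 / c ≤ f' * u ^ 2 := by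
    have : f' * u ^ 2 + (c / 4) * u ^ 4 + f' ^ 2 / c = (c * u ^ 2 / 2 + f') ^ 2 / c := by
      field_simp; ring
    have : 0 ≤ (c * u ^ 2 / 2 + f') ^ 2 / c := by positivity
    linarith
  have e6 : δ * ((u * u) ^ 2 + u ^ 2 + w ^ 2) ≤ (c / 2) * u ^ 4 + c / 4 + (b / 2) * w ^ 2 := by
    have h1 : u ^ 2 ≤ u ^ 4 + 1 := by nlinarith [sq_nonneg (u ^ 2 - 1), sq_nonneg u]
    have h2 : δ * w ^ 2 ≤ (b / 2) * w ^ 2 := by gcongr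
    have h3 : δ * u ^ 4 ≤ (c / 4) * u ^ 4 := by gcongr
    have h4 : δ * u ^ 2 ≤ (c / 4) * (u ^ 4 + 1) := by gcongr
    nlinarith
  have e7 : f * u ^ 2 = f' * u ^ 2 + (e ^ 2 / b) * u ^ 2 + u ^ 2 + (d ^ 2 / c) * u ^ 2 := by
    rw [hf']; ring
  linarith

lemma ineq_CD (c p q r g h : ℝ) (hc : 0 < c) (hp : 0 < p) (hr : 0 < r) :
    ∃ δ K : ℝ, 0 < δ ∧ ∀ u v : ℝ,
    δ * ((u * v) ^ 2 + u ^ 2 + v ^ 2) - K ≤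
      c * (u * v) ^ 2 + p * u ^ 2 + q * (u * v) + r * v ^ 2 + g * u + h * v := by
  refine ⟨min (c / 2) (min (p / 2) (r / 2)), q ^ 2 / (2 * c) + g ^ 2 / (2 * p) + h ^ 2 / (2 * r),
    by positivity, fun u v => ?_⟩
  have m1 : min (c / 2) (min (p / 2) (r / 2)) ≤ c / 2 := min_le_left _ _
  have m2 : min (c / 2) (min (p / 2) (r / 2)) ≤ p / 2 := (min_le_right _ _).trans (min_le_left _ _)
  have m3 : min (c / 2) (min (p / 2) (r / 2)) ≤ r / 2 := (min_le_right _ _).trans (min_le_right _ _)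
  set δ := min (c / 2) (min (p / 2) (r / 2))
  have aux : ∀ a b z : ℝ, 0 < a → -(a / 2) * z ^ 2 - b ^ 2 / (2 * a) ≤ b * z := by
    intro a b z ha
    have : b * z + (a / 2) * z ^ 2 + b ^ 2 / (2 * a) = (a * z + b) ^ 2 / (2 * a) := by
      field_simp; ring
    have : 0 ≤ (a * z + b) ^ 2 / (2 * a) := by positivity
    linarith
  have e1 := aux c q (u * v) hc
  have e2 := aux p g u hp
  have e3 := aux r h v hr
  have h1 : δ * (u * v) ^ 2 ≤ (c / 2) * (u * v) ^ 2 := by gcongr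
  have h2 : δ * u ^ 2 ≤ (p / 2) * u ^ 2 := by gcongr
  have h3 : δ * v ^ 2 ≤ (r / 2) * v ^ 2 := by gcongr
  linarith

lemma count_contra2 (f : ℤ → ℤ → ℤ) (C D : ℤ) (hC : 0 < C)
    (hsurj : ∀ n, D ≤ C * n → ∃ x y, f x y = C * n) (δ K α₁ β₁ α₂ β₂ : ℝ) (hδ : 0 < δ)
    (hdet : α₁ * β₂ - α₂ * β₁ ≠ 0)
    (hb : (∀ x y : ℤ, δ * (((α₁ * x + β₁ * y) * (α₂ * x + β₂ * y)) ^ 2 + (α₁ * x + β₁ * y) ^ 2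
        + (α₂ * x + β₂ * y) ^ 2) - K ≤ f x y) ∨
      (∀ x y : ℤ, δ * (((α₁ * x + β₁ * y) * (α₁ * x + β₁ * y)) ^ 2 + (α₁ * x + β₁ * y) ^ 2
        + (α₂ * x + β₂ * y) ^ 2) - K ≤ f x y)) : False := by
  have h1 : α₁ ≠ 0 ∨ β₁ ≠ 0 := by
    by_contra! h; rw [h.1, h.2] at hdet; simp at hdet
  have h2 : α₂ ≠ 0 ∨ β₂ ≠ 0 := by
    by_contra! h; rw [h.1, h.2] at hdet; simp at hdet
  set Δ := α₁ * β₂ - α₂ * β₁ with hΔ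
  set κ := 1 + 2 * (α₁ ^ 2 + α₂ ^ 2 + β₁ ^ 2 + β₂ ^ 2) / Δ ^ 2 with hκ
  have hκ1 : 1 ≤ κ := by
    have : 0 ≤ 2 * (α₁ ^ 2 + α₂ ^ 2 + β₁ ^ 2 + β₂ ^ 2) / Δ ^ 2 := by positivity
    linarith
  have hκ2 : ∀ x y : ℝ, x ^ 2 + y ^ 2 ≤ κ * ((α₁ * x + β₁ * y) ^ 2 + (α₂ * x + β₂ * y) ^ 2) := by
    intro x y
    set U := α₁ * x + β₁ * y with hU
    set V := α₂ * x + β₂ * y with hV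
    have hx : Δ * x = β₂ * U - β₁ * V := by rw [hU, hV, hΔ]; ring
    have hy : Δ * y = -α₂ * U + α₁ * V := by rw [hU, hV, hΔ]; ring
    have hΔ2 : 0 < Δ ^ 2 := by positivity
    have h3 : Δ ^ 2 * (x ^ 2 + y ^ 2) ≤
        2 * (α₁ ^ 2 + α₂ ^ 2 + β₁ ^ 2 + β₂ ^ 2) * (U ^ 2 + V ^ 2) := by
      have : Δ ^ 2 * (x ^ 2 + y ^ 2) = (Δ * x) ^ 2 + (Δ * y) ^ 2 := by ring
      rw [this, hx, hy]
      nlinarith [sq_nonneg (β₂ * U + β₁ * V), sq_nonneg (α₂ * U + α₁ * V), sq_nonneg (β₂ * V),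
        sq_nonneg (β₁ * U), sq_nonneg (α₁ * U), sq_nonneg (α₂ * V)]
    have h4 : x ^ 2 + y ^ 2 ≤ 2 * (α₁ ^ 2 + α₂ ^ 2 + β₁ ^ 2 + β₂ ^ 2) / Δ ^ 2 * (U ^ 2 + V ^ 2) := by
      rw [div_mul_eq_mul_div, le_div_iff₀ hΔ2]; linarith
    have : 0 ≤ U ^ 2 + V ^ 2 := by positivity
    rw [hκ]; linarith
  have hκ0 : 0 < κ := by linarith
  have main : ∀ Z x y : ℝ, δ / κ * (Z ^ 2 + x ^ 2 + y ^ 2) ≤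
      δ * (Z ^ 2 + (α₁ * x + β₁ * y) ^ 2 + (α₂ * x + β₂ * y) ^ 2) := by
    intro Z x y
    rw [div_mul_eq_mul_div, div_le_iff₀ hκ0, mul_assoc]
    gcongr
    have := hκ2 x y
    nlinarith [sq_nonneg Z]
  rcases hb with hb | hb
  · exact count_contra f C D hC hsurj (δ / κ) K α₁ β₁ α₂ β₂ (by positivity) h1 h2
      fun x y => (by
        have := main ((α₁ * x + β₁ * y) * (α₂ * x + β₂ * y)) x y
        linarith [hb x y])
  · exact count_contra f C D hC hsurj (δ / κ) K α₁ β₁ α₁ β₁ (by positivity) h1 h1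
      fun x y => (by
        have := main ((α₁ * x + β₁ * y) * (α₁ * x + β₁ * y)) x y
        linarith [hb x y])

/-! ### Linear forms attached to a unimodular basis -/

lemma hom_expand {R : Type*} [CommRing R] (G : MvPolynomial (Fin 2) R) (n : ℕ)
    (hG : G.IsHomogeneous n) : ∃ a : ℕ → R,
      G = ∑ i ∈ Finset.range (n + 1), C (a i) * X 0 ^ i * X 1 ^ (n - i) := by
  refine ⟨(MvPolynomial.aeval ![Polynomial.X, 1] G : Polynomial R).coeff, ?_⟩
  conv_lhs => rw [← Polynomial.homogenize_eq_of_isHomogeneous hG rfl]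
  rw [Polynomial.homogenize, Finset.Nat.sum_antidiagonal_eq_sum_range_succ_mk]
  refine Finset.sum_congr rfl fun i _ => ?_
  rw [Finsupp.update_eq_add_single (by simp), MvPolynomial.monomial_single_add,
    ← MvPolynomial.C_mul_X_pow_eq_monomial]
  ring

/-- The linear form `p x + q y`. -/
noncomputable def lin {R : Type*} [CommRing R] (p q : R) : MvPolynomial (Fin 2) R :=
  C p * X 0 + C q * X 1

lemma lin_hom {R : Type*} [CommRing R] (p q : R) : (lin p q).IsHomogeneous 1 :=
  (isHomogeneous_C_mul_X p 0).add (isHomogeneous_C_mul_X q 1)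

lemma lin_coeff0 {R : Type*} [CommRing R] (p q : R) :
    coeff (Finsupp.single 0 1) (lin p q) = p := by
  simp [lin, coeff_C_mul, coeff_X, Finsupp.single_left_inj]

lemma lin_coeff1 {R : Type*} [CommRing R] (p q : R) :
    coeff (Finsupp.single 1 1) (lin p q) = q := by
  simp [lin, coeff_C_mul, coeff_X, Finsupp.single_left_inj]

lemma lin_totalDegree {R : Type*} [CommRing R] (p q : R) (h : p ≠ 0 ∨ q ≠ 0) :
    (lin p q).totalDegree = 1 := by
  apply (lin_hom p q).totalDegree
  intro h0
  rcases h with h | h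
  · exact h (by rw [← lin_coeff0 p q, h0, coeff_zero])
  · exact h (by rw [← lin_coeff1 p q, h0, coeff_zero])

lemma toQ_lin (p q : ℤ) : toQ (lin p q) = lin (p : ℚ) (q : ℚ) := by
  simp [toQ, lin]

lemma lin_irred_Q (p q : ℚ) (h : p ≠ 0 ∨ q ≠ 0) : Irreducible (lin p q) := by
  apply irreducible_of_totalDegree_eq_one (lin_totalDegree p q h)
  intro x hx
  rw [isUnit_iff_ne_zero]
  rintro rfl
  rcases h with h | h
  · exact h (by have := hx (Finsupp.single 0 1); rwa [lin_coeff0, zero_dvd_iff] at this)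
  · exact h (by have := hx (Finsupp.single 1 1); rwa [lin_coeff1, zero_dvd_iff] at this)

lemma lin_prim (p q a b : ℤ) (h : a * p + b * q = 1) : IsPrimitiveInt (lin p q) := by
  intro d hd
  have h0 := hd (Finsupp.single 0 1)
  have h1 := hd (Finsupp.single 1 1)
  rw [lin_coeff0] at h0
  rw [lin_coeff1] at h1
  apply isUnit_of_dvd_one
  rw [← h]
  exact dvd_add (h0.mul_left _) (h1.mul_left _)

lemma lin_prime (p q a b : ℤ) (h : a * p + b * q = 1) : Prime (lin p q) := by
  apply Irreducible.prime
  have hne : p ≠ 0 ∨ q ≠ 0 := by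
    by_contra! h'; rw [h'.1, h'.2] at h; simp at h
  exact irreducible_of_totalDegree_eq_one (lin_totalDegree p q hne) (lin_prim p q a b h)

lemma hom_expand_LM (G : MvPolynomial (Fin 2) ℤ) (n : ℕ) (hG : G.IsHomogeneous n)
    (s₁ s₂ t₁ t₂ : ℤ) (hdet : s₁ * t₂ - s₂ * t₁ = 1) : ∃ a : ℕ → ℤ,
      G = ∑ i ∈ Finset.range (n + 1), C (a i) * lin t₂ (-t₁) ^ i * lin (-s₂) s₁ ^ (n - i) := by
  set φ : MvPolynomial (Fin 2) ℤ →ₐ[ℤ] MvPolynomial (Fin 2) ℤ :=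
    MvPolynomial.aeval ![lin s₁ t₁, lin s₂ t₂] with hφ
  set ψ : MvPolynomial (Fin 2) ℤ →ₐ[ℤ] MvPolynomial (Fin 2) ℤ :=
    MvPolynomial.aeval ![lin t₂ (-t₁), lin (-s₂) s₁] with hψ
  have hφG : (φ G).IsHomogeneous n := by
    have := hG.aeval ![lin s₁ t₁, lin s₂ t₂] (n := 1) (by
      intro i; fin_cases i <;> exact lin_hom _ _)
    rw [one_mul] at this
    exact this
  have hcomp : ψ.comp φ = AlgHom.id ℤ _ := by
    have hdet' : (C s₁ * C t₂ - C s₂ * C t₁ : MvPolynomial (Fin 2) ℤ) = 1 := by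
      rw [← C_mul, ← C_mul, ← C_sub, hdet, C_1]
    apply MvPolynomial.algHom_ext
    intro i
    have hC : ∀ z : ℤ, ψ (C z) = C z := fun z => by simp [hψ]
    have h0 : φ (X 0) = lin s₁ t₁ := by rw [hφ, aeval_X]; rfl
    have h1 : φ (X 1) = lin s₂ t₂ := by rw [hφ, aeval_X]; rfl
    have k0 : ψ (X 0) = lin t₂ (-t₁) := by rw [hψ, aeval_X]; rfl
    have k1 : ψ (X 1) = lin (-s₂) s₁ := by rw [hψ, aeval_X]; rfl
    fin_cases i
    · change ψ (φ (X 0)) = X 0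
      rw [h0, lin, map_add, map_mul, map_mul, hC, hC, k0, k1, lin, lin, C_neg, C_neg]
      linear_combination (X 0 : MvPolynomial (Fin 2) ℤ) * hdet'
    · change ψ (φ (X 1)) = X 1
      rw [h1, lin, map_add, map_mul, map_mul, hC, hC, k0, k1, lin, lin, C_neg, C_neg]
      linear_combination (X 1 : MvPolynomial (Fin 2) ℤ) * hdet'
  obtain ⟨a, ha⟩ := hom_expand _ _ hφG
  refine ⟨a, ?_⟩
  have h1 : ψ (φ G) = G := by
    have := congrArg (fun f => f G) hcomp
    simpa using this
  conv_lhs => rw [← h1, ha]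
  simp [hψ]

lemma eval_lin (p q x y : ℤ) : eval ![x, y] (lin p q) = p * x + q * y := by
  simp [lin]

lemma evalReal_lin (p q : ℤ) (x y : ℝ) : evalReal (lin p q) x y = p * x + q * y := by
  simp [lin, evalReal]

lemma evalReal_add (A B : MvPolynomial (Fin 2) ℤ) (x y : ℝ) :
    evalReal (A + B) x y = evalReal A x y + evalReal B x y := by simp [evalReal]

lemma evalReal_mul (A B : MvPolynomial (Fin 2) ℤ) (x y : ℝ) :
    evalReal (A * B) x y = evalReal A x y * evalReal B x y := by simp [evalReal]

lemma evalReal_pow (A : MvPolynomial (Fin 2) ℤ) (n : ℕ) (x y : ℝ) :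
    evalReal (A ^ n) x y = evalReal A x y ^ n := by simp [evalReal]

lemma evalReal_C (a : ℤ) (x y : ℝ) : evalReal (C a) x y = a := by simp [evalReal]

lemma evalReal_int (A : MvPolynomial (Fin 2) ℤ) (x y : ℤ) :
    evalReal A x y = (eval ![x, y] A : ℤ) := by
  have : (![(x : ℝ), (y : ℝ)]) = algebraMap ℤ ℝ ∘ ![x, y] := by
    ext i; fin_cases i <;> simp
  rw [evalReal, this, MvPolynomial.aeval_algebraMap_apply]
  simp [MvPolynomial.coe_aeval_eq_eval]

/-! ### Elementary facts on polynomials of one variable -/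

lemma first_coeff_zero (a b c d : ℝ)
    (h : ∀ u : ℝ, 0 ≤ d * u + c * u ^ 2 + b * u ^ 3 + a * u ^ 4) : d = 0 := by
  have hmin : IsLocalMin (fun u : ℝ => d * u + c * u ^ 2 + b * u ^ 3 + a * u ^ 4) 0 := by
    apply Filter.Eventually.of_forall
    intro u
    simpa using h u
  have hd : HasDerivAt (fun u : ℝ => d * u + c * u ^ 2 + b * u ^ 3 + a * u ^ 4) d 0 := by
    have := ((((hasDerivAt_id (0 : ℝ)).const_mul d).add ((hasDerivAt_pow 2 (0 : ℝ)).const_mul c)).add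
      ((hasDerivAt_pow 3 (0 : ℝ)).const_mul b)).add ((hasDerivAt_pow 4 (0 : ℝ)).const_mul a)
    exact this.congr_deriv (by simp)
  exact hmin.hasDerivAt_eq_zero hd

lemma quad_bdd (c b D : ℤ) (h : ∀ n : ℤ, D ≤ c * n ^ 2 + b * n) : 0 ≤ c := by
  by_contra! hc
  have h1 := h (|b| + |D| + 1)
  have hb := abs_nonneg b
  have hD := abs_nonneg D
  have hb' := le_abs_self b
  have hD' := neg_abs_le D
  set N := |b| + |D| + 1 with hN
  have h2 : c * N ^ 2 ≤ -1 * N ^ 2 := by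
    have : 0 ≤ N ^ 2 := sq_nonneg _
    have : c ≤ -1 := by omega
    gcongr
  have hN1 : 1 ≤ N := by omega
  have h3 : b * N ≤ |b| * N := by gcongr
  have h4 : |D| ≤ |D| * N := by nlinarith
  nlinarith

lemma cubic_bdd (d c b D : ℤ) (h : ∀ n : ℤ, D ≤ d * n ^ 3 + c * n ^ 2 + b * n) : d = 0 := by
  wlog hd : d < 0 generalizing d b
  · by_contra hne
    have := this (-d) (-b) (fun n => by have := h (-n); ring_nf at this ⊢; linarith) (by omega)
    omega
  exfalso
  have h1 := h (|c| + |b| + |D| + 1)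
  have hb := abs_nonneg b
  have hc := abs_nonneg c
  have hD := abs_nonneg D
  have hb' := le_abs_self b
  have hc' := le_abs_self c
  have hD' := neg_abs_le D
  set N := |c| + |b| + |D| + 1 with hN
  have hN1 : 1 ≤ N := by omega
  have hN2 : N ≤ N ^ 2 := by nlinarith
  have h2 : d * N ^ 3 ≤ -1 * N ^ 3 := by
    have : d ≤ -1 := by omega
    gcongr
  have h3 : b * N ≤ |b| * N ^ 2 := by
    calc b * N ≤ |b| * N := by gcongr
      _ ≤ _ := by gcongr
  have h4 : |D| ≤ |D| * N ^ 2 := by nlinarith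
  have h5 : c * N ^ 2 ≤ |c| * N ^ 2 := by gcongr
  have h6 : N ^ 3 = (|c| + |b| + |D| + 1) * N ^ 2 := by rw [hN]; ring
  nlinarith

/-! ### Rational zeros of the leading form -/

lemma lin_dvd_const {L K : MvPolynomial (Fin 2) ℤ} {t₁ t₂ : ℤ} (hL : eval ![t₁, t₂] L = 0)
    (h : L ∣ K) : eval ![t₁, t₂] K = 0 := by
  obtain ⟨Q, rfl⟩ := h
  simp [hL]

lemma evalReal_zero (x y : ℝ) : evalReal 0 x y = 0 := by simp [evalReal]

set_option maxHeartbeats 1000000 in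
lemma rational_zero (F1 F2 F3 F4 P0 Ft4 : MvPolynomial (Fin 2) ℤ)
    (hF1 : F1.IsHomogeneous 1) (hF2 : F2.IsHomogeneous 2) (hF3 : F3.IsHomogeneous 3)
    (hF4 : F4.IsHomogeneous 4) (hne : F4 ≠ 0) (D : ℤ)
    (hbd : ∀ x y : ℤ, D ≤ eval ![x, y] F1 + eval ![x, y] F2 + eval ![x, y] F3 + eval ![x, y] F4)
    (hpsd : PosSemidef2 F4) (hP0 : PosDef2 P0) (hfac : F4 = P0 * Ft4)
    (hcf : ¬ CommonFactor3 Ft4 F3 F2)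
    (hm : ∀ H : MvPolynomial (Fin 2) ℤ, (∃ n, H.IsHomogeneous n) → IsPrimitiveInt H →
        Irreducible (toQ H) → H ∣ Ft4 → H ∣ F3 → ∀ n4 n3 : ℕ,
          (H ^ n4 ∣ Ft4 ∧ ¬ H ^ (n4 + 1) ∣ Ft4) →
          (H ^ n3 ∣ F3 ∧ ¬ H ^ (n3 + 1) ∣ F3) → 2 * n3 ≠ n4)
    (s₁ s₂ t₁ t₂ : ℤ) (hdet : s₁ * t₂ - s₂ * t₁ = 1) (hz : eval ![t₁, t₂] F4 = 0) :
    ∃ a b c a3 b3 a2 b2 c2 a1 b1 : ℤ,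
      (∀ u w : ℝ, evalReal F4 (s₁ * u + t₁ * w) (s₂ * u + t₂ * w)
        = a * u ^ 4 + b * u ^ 3 * w + c * u ^ 2 * w ^ 2) ∧
      (∀ u w : ℝ, evalReal F3 (s₁ * u + t₁ * w) (s₂ * u + t₂ * w)
        = a3 * u ^ 3 + b3 * u ^ 2 * w) ∧
      (∀ u w : ℝ, evalReal F2 (s₁ * u + t₁ * w) (s₂ * u + t₂ * w)
        = a2 * u ^ 2 + b2 * u * w + c2 * w ^ 2) ∧
      (∀ u w : ℝ, evalReal F1 (s₁ * u + t₁ * w) (s₂ * u + t₂ * w)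
        = a1 * u + b1 * w) ∧ 0 < c2 ∧ (c = 0 → b = 0 ∧ b3 = 0 ∧ a ≠ 0) := by
  obtain ⟨A4, e4⟩ := hom_expand_LM F4 4 hF4 s₁ s₂ t₁ t₂ hdet
  obtain ⟨A3, e3⟩ := hom_expand_LM F3 3 hF3 s₁ s₂ t₁ t₂ hdet
  obtain ⟨A2, e2⟩ := hom_expand_LM F2 2 hF2 s₁ s₂ t₁ t₂ hdet
  obtain ⟨A1, e1⟩ := hom_expand_LM F1 1 hF1 s₁ s₂ t₁ t₂ hdet
  set L := lin t₂ (-t₁) with hLdef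
  set M := lin (-s₂) s₁ with hMdef
  have hLr : ∀ u w : ℝ, evalReal L (s₁ * u + t₁ * w) (s₂ * u + t₂ * w) = u := by
    intro u w
    have : (s₁ * t₂ - s₂ * t₁ : ℝ) = 1 := by exact_mod_cast hdet
    rw [hLdef, evalReal_lin]; push_cast; linear_combination u * this
  have hMr : ∀ u w : ℝ, evalReal M (s₁ * u + t₁ * w) (s₂ * u + t₂ * w) = w := by
    intro u w
    have : (s₁ * t₂ - s₂ * t₁ : ℝ) = 1 := by exact_mod_cast hdet
    rw [hMdef, evalReal_lin]; push_cast; linear_combination w * this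
  have hLt : eval ![t₁, t₂] L = 0 := by rw [hLdef, eval_lin]; ring
  have hMt : eval ![t₁, t₂] M = 1 := by rw [hMdef, eval_lin]; linarith
  simp only [Finset.sum_range_succ, Finset.range_zero, Finset.sum_empty, zero_add,
    pow_zero, mul_one, pow_one, Nat.reduceSub, Nat.sub_zero, Nat.reduceAdd] at e1 e2 e3 e4
  have hLne : L ≠ 0 := by
    intro h
    have := hLr 1 0
    rw [h, evalReal_zero] at this
    norm_num at this
  have hLprime : Prime L := lin_prime t₂ (-t₁) s₁ s₂ (by linarith)
  have hLprim : IsPrimitiveInt L := lin_prim t₂ (-t₁) s₁ s₂ (by linarith)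
  have htne : (t₂ : ℚ) ≠ 0 ∨ ((-t₁ : ℤ) : ℚ) ≠ 0 := by
    by_contra! h
    have h1 : t₂ = 0 := by exact_mod_cast h.1
    have h2 : t₁ = 0 := by simpa using h.2
    rw [h1, h2] at hdet; simp at hdet
  have hLirr : Irreducible (toQ L) := by rw [hLdef, toQ_lin]; exact lin_irred_Q _ _ htne
  have hLP0 : ¬ L ∣ P0 := by
    intro h
    have h1 := lin_dvd_const hLt h
    have h2 := hP0 t₁ t₂ (by
      intro h3
      simp only [Prod.mk.injEq, Int.cast_eq_zero] at h3
      rw [h3.1, h3.2] at hdet; simp at hdet)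
    rw [evalReal_int, h1] at h2
    simp at h2
  have f4z : A4 0 = 0 := by
    rw [e4] at hz
    simpa [hLt, hMt] using hz
  have v4 : ∀ u w : ℝ, evalReal F4 (s₁ * u + t₁ * w) (s₂ * u + t₂ * w) =
      A4 0 * w ^ 4 + A4 1 * u * w ^ 3 + A4 2 * u ^ 2 * w ^ 2 + A4 3 * u ^ 3 * w + A4 4 * u ^ 4 := by
    intro u w
    rw [e4]; simp only [evalReal_add, evalReal_mul, evalReal_pow, evalReal_C, hLr, hMr]
  have v3 : ∀ u w : ℝ, evalReal F3 (s₁ * u + t₁ * w) (s₂ * u + t₂ * w) =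
      A3 0 * w ^ 3 + A3 1 * u * w ^ 2 + A3 2 * u ^ 2 * w + A3 3 * u ^ 3 := by
    intro u w
    rw [e3]; simp only [evalReal_add, evalReal_mul, evalReal_pow, evalReal_C, hLr, hMr]
  have v2 : ∀ u w : ℝ, evalReal F2 (s₁ * u + t₁ * w) (s₂ * u + t₂ * w) =
      A2 0 * w ^ 2 + A2 1 * u * w + A2 2 * u ^ 2 := by
    intro u w
    rw [e2]; simp only [evalReal_add, evalReal_mul, evalReal_pow, evalReal_C, hLr, hMr]
  have v1 : ∀ u w : ℝ, evalReal F1 (s₁ * u + t₁ * w) (s₂ * u + t₂ * w) =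
      A1 0 * w + A1 1 * u := by
    intro u w
    rw [e1]; simp only [evalReal_add, evalReal_mul, evalReal_C, hLr, hMr]
  -- integer lower bound in the new coordinates
  have hbd' : ∀ u w : ℤ, D ≤ (A1 0 * w + A1 1 * u) + (A2 0 * w ^ 2 + A2 1 * u * w + A2 2 * u ^ 2) +
      (A3 0 * w ^ 3 + A3 1 * u * w ^ 2 + A3 2 * u ^ 2 * w + A3 3 * u ^ 3) +
      (A4 0 * w ^ 4 + A4 1 * u * w ^ 3 + A4 2 * u ^ 2 * w ^ 2 + A4 3 * u ^ 3 * w + A4 4 * u ^ 4) := by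
    intro u w
    have h := hbd (s₁ * u + t₁ * w) (s₂ * u + t₂ * w)
    have h' : ((D : ℤ) : ℝ) ≤ _ := Int.cast_le.2 h
    simp only [Int.cast_add, ← evalReal_int] at h'
    simp only [Int.cast_mul] at h'
    rw [v1, v2, v3, v4] at h'
    exact_mod_cast h'
  have hA41 : A4 1 = 0 := by
    have : (A4 1 : ℝ) = 0 := by
      apply first_coeff_zero (A4 4) (A4 3) (A4 2)
      intro u
      have := hpsd (s₁ * u + t₁ * 1) (s₂ * u + t₂ * 1)
      rw [v4, f4z] at this
      norm_num at this
      linarith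
    exact_mod_cast this
  have hA30 : A3 0 = 0 := by
    apply cubic_bdd _ (A2 0) (A1 0) D
    intro n
    have := hbd' 0 n
    rw [f4z] at this
    norm_num at this
    linarith
  have hA20 : 0 ≤ A2 0 := by
    apply quad_bdd _ (A1 0) D
    intro n
    have := hbd' 0 n
    rw [f4z, hA30] at this
    norm_num at this
    linarith
  rw [f4z, hA41] at e4
  rw [hA30] at e3
  simp only [map_zero, zero_mul, zero_add] at e3 e4
  have dvd4 : L ^ 2 ∣ F4 := by
    rw [e4]
    exact ⟨C (A4 2) * M ^ 2 + C (A4 3) * L * M + C (A4 4) * L ^ 2, by ring⟩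
  have toFt : ∀ k, L ^ k ∣ F4 → L ^ k ∣ Ft4 := by
    intro k hk
    rw [hfac] at hk
    exact hLprime.pow_dvd_of_dvd_mul_left k hLP0 hk
  have toF4 : ∀ k, L ^ k ∣ Ft4 → L ^ k ∣ F4 := by
    intro k hk
    rw [hfac]
    exact hk.mul_left _
  have dvdFt : L ∣ Ft4 := (dvd_pow_self L two_ne_zero).trans (toFt 2 dvd4)
  have dvd3 : L ∣ F3 := by
    rw [e3]
    exact ⟨C (A3 1) * M ^ 2 + C (A3 2) * L * M + C (A3 3) * L ^ 2, by ring⟩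
  have hA20' : A2 0 ≠ 0 := by
    intro h
    apply hcf
    refine ⟨toQ L, ?_, map_dvd _ dvdFt, map_dvd _ dvd3, map_dvd _ ?_⟩
    · rw [hLdef, toQ_lin, lin_totalDegree _ _ htne]; norm_num
    · rw [e2, h]
      exact ⟨C (A2 1) * M + C (A2 2) * L, by simp; ring⟩
  have hhom : ∃ n, L.IsHomogeneous n := ⟨1, lin_hom _ _⟩
  by_cases hc : A4 2 = 0
  · have hb : A4 3 = 0 := by
      have : (A4 3 : ℝ) = 0 := by
        apply first_coeff_zero 0 0 (A4 4)
        intro u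
        by_cases hu : u = 0
        · simp [hu]
        have := hpsd (s₁ * u + t₁ * 1) (s₂ * u + t₂ * 1)
        rw [v4, f4z, hA41, hc] at this
        norm_num at this
        have h2 : 0 < u ^ 2 := by positivity
        have h3 : 0 ≤ u ^ 2 * (A4 3 * u + A4 4 * u ^ 2 + 0 * u ^ 3 + 0 * u ^ 4) := by linarith
        exact nonneg_of_mul_nonneg_right h3 h2
      exact_mod_cast this
    rw [hc, hb] at e4
    simp only [map_zero, zero_mul, zero_add] at e4
    have ha : A4 4 ≠ 0 := by
      intro h
      rw [h] at e4
      simp at e4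
      exact hne e4
    have hA31 : A3 1 = 0 := by
      have hk : ∀ k : ℤ, 0 ≤ A3 1 * k + A2 0 := by
        intro k
        apply quad_bdd _ (A1 0 + A2 1 * k + A3 2 * k ^ 2)
          (D - A1 1 * k - A2 2 * k ^ 2 - A3 3 * k ^ 3 - A4 4 * k ^ 4)
        intro n
        have := hbd' k n
        rw [f4z, hA30, hA41, hc, hb] at this
        norm_num at this
        linarith
      have k1 := hk (A2 0 + 1)
      have k2 := hk (-(A2 0 + 1))
      by_contra h
      rcases lt_or_gt_of_ne h with h | h <;> nlinarith
    rw [hA31] at e3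
    simp only [map_zero, zero_mul, zero_add] at e3
    have hA32 : A3 2 = 0 := by
      by_contra hcon
      refine hm L hhom hLprim hLirr dvdFt dvd3 4 2 ⟨toFt 4 ?_, fun h => ?_⟩ ⟨?_, fun h => ?_⟩ (by norm_num)
      · rw [e4]; exact Dvd.intro_left _ rfl
      · have h5 := toF4 5 h
        rw [e4, mul_comm, pow_succ, mul_dvd_mul_iff_left (pow_ne_zero 4 hLne)] at h5
        have := lin_dvd_const hLt h5
        simp at this
        exact ha this
      · rw [e3]
        exact ⟨C (A3 2) * M + C (A3 3) * L, by ring⟩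
      · have e : F3 = L ^ 2 * (C (A3 2) * M + C (A3 3) * L) := by rw [e3]; ring
        rw [e, pow_succ, mul_dvd_mul_iff_left (pow_ne_zero 2 hLne)] at h
        have := lin_dvd_const hLt h
        simp [hLt, hMt] at this
        exact hcon this
    refine ⟨A4 4, A4 3, A4 2, A3 3, A3 2, A2 2, A2 1, A2 0, A1 1, A1 0, ?_, ?_, ?_, ?_, ?_, ?_⟩
    · intro u w; rw [v4, f4z, hA41]; push_cast; ring
    · intro u w; rw [v3, hA30, hA31]; push_cast; ring
    · intro u w; rw [v2]; ring
    · intro u w; rw [v1]; ring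
    · omega
    · exact fun _ => ⟨hb, hA32, ha⟩
  · have hA31 : A3 1 = 0 := by
      by_contra hcon
      refine hm L hhom hLprim hLirr dvdFt dvd3 2 1 ⟨toFt 2 dvd4, fun h => ?_⟩ ⟨?_, fun h => ?_⟩
        (by norm_num)
      · have h5 := toF4 3 h
        have e : F4 = L ^ 2 * (C (A4 2) * M ^ 2 + L * (C (A4 3) * M + C (A4 4) * L)) := by
          rw [e4]; ring
        rw [e, pow_succ, mul_dvd_mul_iff_left (pow_ne_zero 2 hLne)] at h5
        have := lin_dvd_const hLt h5
        simp [hLt, hMt] at this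
        exact hc this
      · simpa using dvd3
      · have e : F3 = L ^ 1 * (C (A3 1) * M ^ 2 + L * (C (A3 2) * M + C (A3 3) * L)) := by
          rw [e3]; ring
        rw [e, pow_succ, mul_dvd_mul_iff_left (pow_ne_zero 1 hLne)] at h
        have := lin_dvd_const hLt h
        simp [hLt, hMt] at this
        exact hcon this
    refine ⟨A4 4, A4 3, A4 2, A3 3, A3 2, A2 2, A2 1, A2 0, A1 1, A1 0, ?_, ?_, ?_, ?_, ?_, ?_⟩
    · intro u w; rw [v4, f4z, hA41]; push_cast; ring
    · intro u w; rw [v3, hA30, hA31]; push_cast; ring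
    · intro u w; rw [v2]; ring
    · intro u w; rw [v1]; ring
    · omega
    · exact fun h => absurd h hc

set_option maxHeartbeats 1000000 in
lemma rational_case (F1 F2 F3 F4 P0 Ft4 : MvPolynomial (Fin 2) ℤ)
    (hF1 : F1.IsHomogeneous 1) (hF2 : F2.IsHomogeneous 2) (hF3 : F3.IsHomogeneous 3)
    (hF4 : F4.IsHomogeneous 4) (hne : F4 ≠ 0) (C' D : ℤ) (hC : 0 < C')
    (hbd : ∀ x y : ℤ, D ≤ eval ![x, y] F1 + eval ![x, y] F2 + eval ![x, y] F3 + eval ![x, y] F4)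
    (hsurj : ∀ n, D ≤ C' * n → ∃ x y : ℤ,
      eval ![x, y] F1 + eval ![x, y] F2 + eval ![x, y] F3 + eval ![x, y] F4 = C' * n)
    (hpsd : PosSemidef2 F4) (hP0 : PosDef2 P0) (hfac : F4 = P0 * Ft4)
    (hcf : ¬ CommonFactor3 Ft4 F3 F2)
    (hm : ∀ H : MvPolynomial (Fin 2) ℤ, (∃ n, H.IsHomogeneous n) → IsPrimitiveInt H →
        Irreducible (toQ H) → H ∣ Ft4 → H ∣ F3 → ∀ n4 n3 : ℕ,
          (H ^ n4 ∣ Ft4 ∧ ¬ H ^ (n4 + 1) ∣ Ft4) →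
          (H ^ n3 ∣ F3 ∧ ¬ H ^ (n3 + 1) ∣ F3) → 2 * n3 ≠ n4)
    (s₁ s₂ t₁ t₂ : ℤ) (hdet : s₁ * t₂ - s₂ * t₁ = 1) (hz : eval ![t₁, t₂] F4 = 0) : False := by
  obtain ⟨a, b, c, a3, b3, a2, b2, c2, a1, b1, v4, v3, v2, v1, hc2, hc0⟩ :=
    rational_zero F1 F2 F3 F4 P0 Ft4 hF1 hF2 hF3 hF4 hne D hbd hpsd hP0 hfac hcf hm
      s₁ s₂ t₁ t₂ hdet hz
  have hdetR : (s₁ * t₂ - s₂ * t₁ : ℝ) = 1 := by exact_mod_cast hdet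
  have hc2R : (0 : ℝ) < c2 := by exact_mod_cast hc2
  have hpos : ∀ u w : ℝ, 0 ≤ a * u ^ 4 + b * u ^ 3 * w + c * u ^ 2 * w ^ 2 := fun u w => by
    rw [← v4]; exact hpsd _ _
  have hval : ∀ x y : ℤ, ∀ u w : ℝ, u = t₂ * x + (-t₁) * y → w = -s₂ * x + s₁ * y →
      ((eval ![x, y] F1 + eval ![x, y] F2 + eval ![x, y] F3 + eval ![x, y] F4 : ℤ) : ℝ) =
      (a1 * u + b1 * w) + (a2 * u ^ 2 + b2 * u * w + c2 * w ^ 2) + (a3 * u ^ 3 + b3 * u ^ 2 * w)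
      + (a * u ^ 4 + b * u ^ 3 * w + c * u ^ 2 * w ^ 2) := by
    intro x y u w hu hw
    have hx : (x : ℝ) = s₁ * u + t₁ * w := by
      rw [hu, hw]; linear_combination (-(x : ℝ)) * hdetR
    have hy : (y : ℝ) = s₂ * u + t₂ * w := by
      rw [hu, hw]; linear_combination (-(y : ℝ)) * hdetR
    rw [← v4, ← v3, ← v2, ← v1, ← hx, ← hy]
    simp only [Int.cast_add, evalReal_int]
  set f : ℤ → ℤ → ℤ := fun x y =>
    eval ![x, y] F1 + eval ![x, y] F2 + eval ![x, y] F3 + eval ![x, y] F4 with hf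
  have ha0 : (0 : ℝ) ≤ a := by have := hpos 1 0; norm_num at this; exact_mod_cast this
  by_cases hc : c = 0
  · obtain ⟨hb, hb3, ha⟩ := hc0 hc
    have ha' : (0 : ℝ) < a := by
      have : (a : ℝ) ≠ 0 := by exact_mod_cast ha
      positivity
    obtain ⟨δ, K, hδ, hK⟩ := ineq_A a c2 a3 b2 a2 a1 b1 ha' hc2R
    refine count_contra2 f C' D hC hsurj δ K t₂ (-t₁) (-s₂) s₁ hδ ?_ (Or.inr ?_)
    · intro h; linarith
    · intro x y
      rw [hval x y _ _ rfl rfl]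
      refine (hK _ _).trans (le_of_eq ?_)
      rw [hb, hb3, hc]; push_cast; ring
  have hdisc : (b : ℝ) ^ 2 - 4 * c * a ≤ 0 := by
    have := discrim_le_zero (a := (c : ℝ)) (b := b) (c := a) (fun w => by
      have := hpos 1 w; norm_num at this; linarith)
    simpa [discrim] using this
  have hcR : (c : ℝ) ≠ 0 := by exact_mod_cast hc
  have hcpos : (0 : ℝ) < c := by
    rcases ha0.eq_or_lt with h | h
    · rw [← h] at hdisc
      have hb : (b : ℝ) = 0 := by nlinarith
      have := hpos 1 1
      rw [← h, hb] at this
      norm_num at this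
      have : (0 : ℝ) ≤ c := by exact_mod_cast this
      positivity
    · by_contra! hcn
      have : (c : ℝ) < 0 := lt_of_le_of_ne hcn hcR
      nlinarith [sq_nonneg (b : ℝ)]
  by_cases hd : (b : ℝ) ^ 2 - 4 * c * a < 0
  · have hε : (0 : ℝ) < a - b ^ 2 / (4 * c) := by
      rw [sub_pos, div_lt_iff₀ (by positivity)]; linarith
    obtain ⟨δ, K, hδ, hK⟩ := ineq_A (a - b ^ 2 / (4 * c)) c2 (a3 - b * b3 / (2 * c)) b2
      (a2 - b3 ^ 2 / (4 * c)) a1 b1 hε hc2R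
    refine count_contra2 f C' D hC hsurj δ K t₂ (-t₁) (-s₂) s₁ hδ ?_ (Or.inr ?_)
    · intro h; linarith
    · intro x y
      rw [hval x y _ _ rfl rfl]
      set u : ℝ := t₂ * x + (-t₁) * y
      set w : ℝ := -s₂ * x + s₁ * y
      refine (hK u w).trans ?_
      rw [← sub_nonneg]
      have : 0 ≤ u ^ 2 * (2 * c * w + b * u + b3) ^ 2 / (4 * c) := by positivity
      refine this.trans (le_of_eq ?_)
      field_simp
      ring
  · have hd0 : (b : ℝ) ^ 2 - 4 * c * a = 0 := le_antisymm hdisc (not_lt.1 hd)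
    have hcZ : 0 < c := by exact_mod_cast hcpos
    -- the second rational direction
    have hg : 0 < Int.gcd (2 * c) (-b) := Int.gcd_pos_of_ne_zero_left _ (by omega)
    obtain ⟨g, p, q, hgpos, hcop, hp, hq⟩ := Int.exists_gcd_one' hg
    obtain ⟨k, l, hkl⟩ := Int.isCoprime_iff_gcd_eq_one.2 hcop
    have hgR : (0 : ℝ) < g := by exact_mod_cast hgpos
    have hpR : (2 * c : ℝ) = p * g := by exact_mod_cast hp
    have hqR : (-b : ℝ) = q * g := by exact_mod_cast hq
    have hklR : (k * p + l * q : ℝ) = 1 := by exact_mod_cast hkl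
    have hp0 : (p : ℝ) ≠ 0 := by
      intro h; rw [h] at hpR; apply hcR; linarith
    have hz' : eval ![s₁ * p + t₁ * q, s₂ * p + t₂ * q] F4 = 0 := by
      have h1 := v4 p q
      have h2 : evalReal F4 ((s₁ * p + t₁ * q : ℤ) : ℝ) ((s₂ * p + t₂ * q : ℤ) : ℝ) = 0 := by
        push_cast
        rw [h1]
        have h3 : (g : ℝ) ^ 2 * (a * p ^ 2 + b * p * q + c * q ^ 2) = 0 := by
          have : (g : ℝ) ^ 2 * (a * p ^ 2 + b * p * q + c * q ^ 2) =
            a * (p * g) ^ 2 + b * (p * g) * (q * g) + c * (q * g) ^ 2 := by ring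
          rw [this, ← hpR, ← hqR]
          linear_combination (-(c : ℝ)) * hd0
        have h4 := (mul_eq_zero.1 h3).resolve_left (by positivity)
        linear_combination (p : ℝ) ^ 2 * h4
      rw [evalReal_int] at h2
      exact_mod_cast h2
    obtain ⟨a', b', c', a3', b3', a2', b2', c2', a1', b1', -, v3', v2', -, hc2', -⟩ :=
      rational_zero F1 F2 F3 F4 P0 Ft4 hF1 hF2 hF3 hF4 hne D hbd hpsd hP0 hfac hcf hm
        (s₁ * l + t₁ * (-k)) (s₂ * l + t₂ * (-k)) (s₁ * p + t₁ * q) (s₂ * p + t₂ * q)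
        (by linear_combination (k * p + l * q) * hdet + hkl) hz'
    have hF3' : ∀ U W : ℝ, a3 * (l * U + p * W) ^ 3 + b3 * (l * U + p * W) ^ 2 * (-k * U + q * W)
        = a3' * U ^ 3 + b3' * U ^ 2 * W := by
      intro U W
      rw [← v3', ← v3]
      push_cast
      congr 1 <;> ring
    have hF2' : a2 * (p : ℝ) ^ 2 + b2 * p * q + c2 * q ^ 2 = c2' := by
      have h1 := v2' 0 1
      have h2 := v2 p q
      push_cast at h1
      rw [show (s₁ * l + t₁ * (-k) : ℝ) * 0 + (s₁ * p + t₁ * q) * 1 = s₁ * p + t₁ * q by ring,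
        show (s₂ * l + t₂ * (-k) : ℝ) * 0 + (s₂ * p + t₂ * q) * 1 = s₂ * p + t₂ * q by ring, h2] at h1
      linarith
    have k0 : (a3 * p + b3 * q : ℝ) = 0 := by
      have h1 := hF3' 0 1
      have : (p : ℝ) ^ 2 * (a3 * p + b3 * q) = 0 := by linear_combination h1
      exact (mul_eq_zero.1 this).resolve_left (by positivity)
    have k1 : (3 * a3 * l * p ^ 2 + b3 * (2 * l * p * q - k * p ^ 2) : ℝ) = 0 := by
      have h1 := hF3' 1 1
      have h2 := hF3' (-1) 1
      have h3 := hF3' 1 0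
      linear_combination (1 / 2) * h1 - (1 / 2) * h2 - h3
    have hb3 : (b3 : ℝ) = 0 := by
      have : (b3 : ℝ) * p = 0 := by
        linear_combination (3 * l * p : ℝ) * k0 - k1 - (b3 * p : ℝ) * hklR
      exact (mul_eq_zero.1 this).resolve_right hp0
    have ha3 : (a3 : ℝ) = 0 := by
      rw [hb3] at k0
      have : (a3 : ℝ) * p = 0 := by linarith
      exact (mul_eq_zero.1 this).resolve_right hp0
    have hpp : (0 : ℝ) < a2 - b2 * b / (2 * c) + c2 * b ^ 2 / (4 * c ^ 2) := by
      have hc2R' : (0 : ℝ) < c2' := by exact_mod_cast hc2'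
      have : (a2 - b2 * b / (2 * c) + c2 * b ^ 2 / (4 * c ^ 2) : ℝ) = g ^ 2 * c2' / (4 * c ^ 2) := by
        rw [← hF2']
        have : (g : ℝ) ^ 2 * (a2 * (p : ℝ) ^ 2 + b2 * p * q + c2 * q ^ 2) =
            a2 * (p * g) ^ 2 + b2 * (p * g) * (q * g) + c2 * (q * g) ^ 2 := by ring
        rw [this, ← hpR, ← hqR]
        field_simp
        ring
      rw [this]; positivity
    obtain ⟨δ, K, hδ, hK⟩ := ineq_CD (1 / (4 * c)) _ (b2 / (2 * c) - 2 * c2 * b / (4 * c ^ 2))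
      (c2 / (4 * c ^ 2)) (a1 - b1 * b / (2 * c)) (b1 / (2 * c)) (by positivity) hpp (by positivity)
    refine count_contra2 f C' D hC hsurj δ K t₂ (-t₁) (-2 * c * s₂ + b * t₂) (2 * c * s₁ - b * t₁)
      hδ ?_ (Or.inl ?_)
    · intro h
      apply hcR
      linear_combination (1 / 2) * h - (c : ℝ) * hdetR
    · intro x y
      rw [hval x y _ _ rfl rfl, ha3, hb3]
      refine (hK _ _).trans (le_of_eq ?_)
      have ea : (a : ℝ) = b ^ 2 / (4 * c) := by
        rw [eq_div_iff (by positivity)]; linarith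
      rw [ea]
      field_simp
      ring

lemma irr_comb (ξ : ℝ) (hξ : Irrational ξ) (A B : ℤ) (h : (A : ℝ) * ξ + B = 0) : A = 0 ∧ B = 0 := by
  have hA : A = 0 := by
    by_contra hA
    have hA' : (A : ℝ) ≠ 0 := by exact_mod_cast hA
    apply hξ
    refine ⟨(-B : ℚ) / A, ?_⟩
    push_cast
    field_simp
    linarith
  refine ⟨hA, ?_⟩
  rw [hA] at h
  simpa using h

set_option maxHeartbeats 1000000 in
/-- Positivity of the quadratic part at an irrational root. -/
lemma irr_pos (k α β γ p q r g h D : ℤ)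
    (hbd : ∀ x y : ℤ, D ≤ k * (α * x ^ 2 + β * (x * y) + γ * y ^ 2) ^ 2 +
      (p * x ^ 2 + q * (x * y) + r * y ^ 2) + (g * x + h * y))
    (hnp : ¬ (α * q = β * p ∧ α * r = γ * p))
    (ξ : ℝ) (hξ : Irrational ξ) (hroot : α * ξ ^ 2 + β * ξ + γ = 0) :
    0 < p * ξ ^ 2 + q * ξ + r := by
  by_contra hneg
  have hne : p * ξ ^ 2 + q * ξ + r ≠ 0 := by
    intro h0
    have h1 : ((α * q - β * p : ℤ) : ℝ) * ξ + ((α * r - γ * p : ℤ) : ℝ) = 0 := by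
      push_cast
      linear_combination α * h0 - p * hroot
    have := irr_comb ξ hξ _ _ h1
    exact hnp ⟨by linarith [this.1], by linarith [this.2]⟩
  have hlt : p * ξ ^ 2 + q * ξ + r < 0 := lt_of_le_of_ne (not_lt.mp hneg) hne
  set c : ℝ := -(p * ξ ^ 2 + q * ξ + r) with hc
  have hcpos : 0 < c := by rw [hc]; linarith
  set M : ℝ := |(α : ℝ)| + |2 * α * ξ + β| with hM
  set K1 : ℝ := |(k : ℝ)| * M ^ 2 + |(p : ℝ)| + |2 * p * ξ + q| + |(g : ℝ)| + |(D : ℝ)| with hK1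
  set K2 : ℝ := |g * ξ + h| with hK2
  have hM0 : 0 ≤ M := by positivity
  have hK10 : 0 ≤ K1 := by positivity
  have hK20 : 0 ≤ K2 := by positivity
  have key : ∀ s : ℚ, |ξ - s| < 1 / (s.den : ℝ) ^ 2 → (s.den : ℝ) ≤ (K1 + K2) / c := by
    intro s hs
    have hd1 : (1 : ℝ) ≤ s.den := by exact_mod_cast s.pos
    set d : ℝ := (s.den : ℝ) with hd
    have hd0 : 0 < d := by linarith
    set u : ℝ := s.num - ξ * d with hu
    have hsd : (s : ℝ) * d = s.num := by
      rw [hd]; exact_mod_cast Rat.mul_den_eq_num s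
    have hud : |u * d| < 1 := by
      have : u * d = -((ξ - s) * d ^ 2) := by rw [hu, ← hsd]; ring
      rw [this, abs_neg, abs_mul, abs_of_pos (by positivity : 0 < d ^ 2)]
      rwa [lt_div_iff₀ (by positivity)] at hs
    have hu1 : |u| ≤ 1 := by
      rw [abs_mul, abs_of_pos hd0] at hud
      nlinarith [abs_nonneg u]
    have hu2 : |u ^ 2| ≤ 1 := by
      rw [abs_pow]; nlinarith [abs_nonneg u]
    have bd : ∀ A t : ℝ, |t| ≤ 1 → |A * t| ≤ |A| := by
      intro A t ht
      rw [abs_mul]; nlinarith [abs_nonneg A]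
    have hQ : α * (s.num : ℝ) ^ 2 + β * (s.num * d) + γ * d ^ 2 =
        α * u ^ 2 + (2 * α * ξ + β) * (u * d) := by
      rw [hu]; linear_combination d ^ 2 * hroot
    have hQM : |α * (s.num : ℝ) ^ 2 + β * (s.num * d) + γ * d ^ 2| ≤ M := by
      rw [hQ]
      refine (abs_add_le _ _).trans ?_
      exact add_le_add (bd _ _ hu2) (bd _ _ hud.le)
    have hQM2 : k * (α * (s.num : ℝ) ^ 2 + β * (s.num * d) + γ * d ^ 2) ^ 2 ≤ |(k : ℝ)| * M ^ 2 := by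
      have h1 := sq_le_sq' (by linarith [(abs_le.mp hQM).1]) (abs_le.mp hQM).2
      calc _ ≤ |(k : ℝ)| * (α * (s.num : ℝ) ^ 2 + β * (s.num * d) + γ * d ^ 2) ^ 2 :=
            mul_le_mul_of_nonneg_right (le_abs_self _) (sq_nonneg _)
        _ ≤ _ := mul_le_mul_of_nonneg_left h1 (abs_nonneg _)
    have hF2 : p * (s.num : ℝ) ^ 2 + q * (s.num * d) + r * d ^ 2 =
        p * u ^ 2 + (2 * p * ξ + q) * (u * d) - c * d ^ 2 := by
      rw [hu, hc]; ring
    have hL : g * (s.num : ℝ) + h * d = g * u + (g * ξ + h) * d := by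
      rw [hu]; ring
    have hD := hbd s.num s.den
    have hD' : (D : ℝ) ≤ k * (α * (s.num : ℝ) ^ 2 + β * (s.num * d) + γ * d ^ 2) ^ 2 +
      (p * (s.num : ℝ) ^ 2 + q * (s.num * d) + r * d ^ 2) + (g * s.num + h * d) := by
      rw [hd]; exact_mod_cast hD
    rw [hF2, hL] at hD'
    have e1 := le_trans (le_abs_self _) (bd p _ hu2)
    have e2 := le_trans (le_abs_self _) (bd (2 * p * ξ + q) _ hud.le)
    have e3 := le_trans (le_abs_self _) (bd g _ hu1)
    have e4 : (g * ξ + h) * d ≤ K2 * d := mul_le_mul_of_nonneg_right (le_abs_self _) hd0.le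
    have e5 := neg_abs_le (D : ℝ)
    have e6 : c * d ^ 2 ≤ K1 + K2 * d := by rw [hK1]; linarith
    rw [le_div_iff₀ hcpos]
    have e7 : c * d ^ 2 ≤ (K1 + K2) * d := by
      have e9 := mul_le_mul_of_nonneg_left hd1 hK10
      linarith
    have e8 : (d * c) * d ≤ (K1 + K2) * d := by linarith
    exact le_of_mul_le_mul_right e8 hd0
  have hinf := Real.infinite_rat_abs_sub_lt_one_div_den_sq_of_irrational hξ
  apply hinf
  obtain ⟨N, hN⟩ := exists_nat_ge ((K1 + K2) / c)
  obtain ⟨B, hB⟩ := exists_nat_ge (|ξ| * N + N)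
  have hfin : (Set.Icc (-(B : ℤ)) B ×ˢ Set.Icc 0 N).Finite :=
    (Set.finite_Icc _ _).prod (Set.finite_Icc _ _)
  refine Set.Finite.of_finite_image (f := fun s : ℚ => (s.num, s.den)) (hfin.subset ?_) ?_
  · rintro _ ⟨s, hs, rfl⟩
    have hs' : |ξ - s| < 1 / (s.den : ℝ) ^ 2 := hs
    have hk := (key s hs').trans hN
    have hd1 : (1 : ℝ) ≤ s.den := by exact_mod_cast s.pos
    have hsd : (s : ℝ) * s.den = s.num := by exact_mod_cast Rat.mul_den_eq_num s
    have h1 : |ξ - s| ≤ 1 := by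
      refine hs'.le.trans ?_
      rw [div_le_one (by positivity)]
      nlinarith
    have h2 : |(s : ℝ)| ≤ |ξ| + 1 := by
      have := abs_sub_abs_le_abs_sub (s : ℝ) ξ
      rw [abs_sub_comm] at this
      linarith
    have h3 : |(s.num : ℝ)| ≤ B := by
      rw [← hsd, abs_mul, abs_of_pos (by linarith : (0:ℝ) < s.den)]
      refine le_trans ?_ hB
      have : |(s : ℝ)| * s.den ≤ (|ξ| + 1) * N := by
        apply mul_le_mul h2 hk (by linarith) (by positivity)
      linarith
    have h4 : |s.num| ≤ (B : ℤ) := by exact_mod_cast h3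
    simp only [Set.mem_prod, Set.mem_Icc]
    exact ⟨abs_le.mp h4, Nat.zero_le _, by exact_mod_cast hk⟩
  · intro s _ t _ hst
    simp only [Prod.mk.injEq] at hst
    exact Rat.ext hst.1 hst.2

/-- The final contradiction in the irrational case. -/
lemma irr_contra (k α β γ p q r g h C' D : ℤ) (hC : 0 < C') (hk : 0 < k) (hα : α ≠ 0)
    (hbd : ∀ x y : ℤ, D ≤ k * (α * x ^ 2 + β * (x * y) + γ * y ^ 2) ^ 2 +
      (p * x ^ 2 + q * (x * y) + r * y ^ 2) + (g * x + h * y))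
    (hsurj : ∀ n : ℤ, D ≤ C' * n → ∃ x y : ℤ, k * (α * x ^ 2 + β * (x * y) + γ * y ^ 2) ^ 2 +
      (p * x ^ 2 + q * (x * y) + r * y ^ 2) + (g * x + h * y) = C' * n)
    (hnp : ¬ (α * q = β * p ∧ α * r = γ * p))
    (ξ : ℝ) (hξ : Irrational ξ) (hroot : α * ξ ^ 2 + β * ξ + γ = 0) : False := by
  have hα' : (α : ℝ) ≠ 0 := by exact_mod_cast hα
  obtain ⟨ξ', hξ'⟩ : ∃ ξ' : ℝ, α * (ξ + ξ') = -β := ⟨-β / α - ξ, by field_simp; ring⟩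
  have hprod : α * (ξ * ξ') = γ := by linear_combination ξ * hξ' - hroot
  have hroot' : α * ξ' ^ 2 + β * ξ' + γ = 0 := by linear_combination ξ' * hξ' - hprod
  have hirr' : Irrational ξ' := by
    rintro ⟨s, hs⟩
    apply hξ
    refine ⟨(-β : ℚ) / α - s, ?_⟩
    push_cast
    rw [hs]
    field_simp
    linarith
  have hne : ξ' - ξ ≠ 0 := by
    intro h0
    have h1 : ξ' = ξ := by linarith
    rw [h1] at hξ'
    have := irr_comb ξ hξ (2 * α) β (by push_cast; linarith)
    apply hα; linarith [this.1]
  have h1 := irr_pos k α β γ p q r g h D hbd hnp ξ hξ hroot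
  have h2 := irr_pos k α β γ p q r g h D hbd hnp ξ' hirr' hroot'
  set Δ := ξ' - ξ with hΔ
  have hΔ2 : 0 < Δ ^ 2 := by positivity
  obtain ⟨δ, K, hδ, hin⟩ := ineq_CD (k * α ^ 2) ((p * ξ' ^ 2 + q * ξ' + r) / Δ ^ 2)
    (-(2 * p * ξ * ξ' + q * (ξ + ξ') + 2 * r) / Δ ^ 2) ((p * ξ ^ 2 + q * ξ + r) / Δ ^ 2)
    ((g * ξ' + h) / Δ) (-(g * ξ + h) / Δ) (by have : (0:ℝ) < k := by exact_mod_cast hk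
                                              positivity) (by positivity) (by positivity)
  refine count_contra2 (fun x y => k * (α * x ^ 2 + β * (x * y) + γ * y ^ 2) ^ 2 +
      (p * x ^ 2 + q * (x * y) + r * y ^ 2) + (g * x + h * y)) C' D hC hsurj δ K
      1 (-ξ) 1 (-ξ') hδ (by intro h0; apply hne; linarith) (Or.inl ?_)
  intro x y
  refine (hin _ _).trans (le_of_eq ?_)
  push_cast
  have hUV : (α : ℝ) * ((1 * x + -ξ * y) * (1 * x + -ξ' * y)) = α * x ^ 2 + β * (x * y) + γ * y ^ 2 := by
    linear_combination -(x * y : ℝ) * hξ' + (y : ℝ) ^ 2 * hprod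
  rw [← hUV]
  have hx : (x : ℝ) * Δ = ξ' * (1 * x + -ξ * y) - ξ * (1 * x + -ξ' * y) := by rw [hΔ]; ring
  have hy : (y : ℝ) * Δ = (1 * x + -ξ * y) - (1 * x + -ξ' * y) := by rw [hΔ]; ring
  field_simp
  rw [hΔ]
  ring

/-- Gauss lemma, integral version. -/
lemma gauss_C (H : MvPolynomial (Fin 2) ℤ) (hH : IsPrimitiveInt H) (m : ℤ) (hm : m ≠ 0) :
    ∀ G : MvPolynomial (Fin 2) ℤ, H ∣ C m * G → H ∣ G := by
  induction m using UniqueFactorizationMonoid.induction_on_prime with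
  | h₁ => exact absurd rfl hm
  | h₂ x hx =>
    intro G hG
    exact (((hx.map (C : ℤ →+* MvPolynomial (Fin 2) ℤ)).dvd_mul_left).mp hG)
  | h₃ a p ha hp ih =>
    intro G hG
    apply ih ha
    obtain ⟨K, hK⟩ := hG
    have hCp : Prime (C p : MvPolynomial (Fin 2) ℤ) := (MvPolynomial.prime_C_iff (Fin 2)).mpr hp
    have h1 : C p ∣ H * K := by
      rw [← hK, C_mul]
      exact ⟨C a * G, by ring⟩
    rcases hCp.dvd_or_dvd h1 with h2 | h2
    · rw [C_dvd_iff_dvd_coeff] at h2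
      exact absurd (hH p h2) hp.not_isUnit
    · obtain ⟨K', rfl⟩ := h2
      refine ⟨K', ?_⟩
      apply mul_left_cancel₀ hCp.ne_zero
      rw [C_mul] at hK
      linear_combination hK

lemma toQ_mul (A B : MvPolynomial (Fin 2) ℤ) : toQ (A * B) = toQ A * toQ B := by simp [toQ]

lemma toQ_C (a : ℤ) : toQ (C a) = C (a : ℚ) := by simp [toQ]

lemma toQ_inj {A B : MvPolynomial (Fin 2) ℤ} (h : toQ A = toQ B) : A = B :=
  MvPolynomial.map_injective _ Int.cast_injective h

lemma clear_denom (K : MvPolynomial (Fin 2) ℚ) :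
    ∃ (m : ℤ) (K' : MvPolynomial (Fin 2) ℤ), m ≠ 0 ∧ toQ K' = C (m : ℚ) * K := by
  induction K using MvPolynomial.induction_on with
  | C a =>
    refine ⟨a.den, C a.num, by exact_mod_cast a.den_nz, ?_⟩
    rw [toQ_C, ← C_mul]
    congr 1
    push_cast
    exact (Rat.den_mul_eq_num a).symm
  | add p q hp hq =>
    obtain ⟨m, P, hm, hP⟩ := hp
    obtain ⟨n, Q, hn, hQ⟩ := hq
    refine ⟨m * n, C n * P + C m * Q, mul_ne_zero hm hn, ?_⟩
    have : toQ (C n * P + C m * Q) = C (n:ℚ) * toQ P + C (m:ℚ) * toQ Q := by simp [toQ]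
    rw [this, hP, hQ]
    push_cast
    rw [C_mul]
    ring
  | mul_X p i hp =>
    obtain ⟨m, P, hm, hP⟩ := hp
    refine ⟨m, P * X i, hm, ?_⟩
    have : toQ (P * X i) = toQ P * X i := by simp [toQ]
    rw [this, hP]
    ring

/-- Gauss lemma. -/
lemma gauss_toQ (H G : MvPolynomial (Fin 2) ℤ) (hH : IsPrimitiveInt H) (h : toQ H ∣ toQ G) :
    H ∣ G := by
  obtain ⟨K, hK⟩ := h
  obtain ⟨m, K', hm, hK'⟩ := clear_denom K
  apply gauss_C H hH m hm
  refine ⟨K', toQ_inj ?_⟩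
  rw [toQ_mul, toQ_mul, toQ_C, hK, hK']
  ring

lemma prime_of_toQ (H : MvPolynomial (Fin 2) ℤ) (hH : IsPrimitiveInt H)
    (h : Irreducible (toQ H)) : Prime H := by
  have hp := h.prime
  refine ⟨?_, ?_, ?_⟩
  · rintro rfl
    exact hp.ne_zero (by simp [toQ])
  · intro hu
    exact hp.not_isUnit (hu.map (MvPolynomial.map (Int.castRingHom ℚ)))
  · intro a b hab
    have : toQ H ∣ toQ a * toQ b := by
      rw [← toQ_mul]; exact _root_.map_dvd (MvPolynomial.map (Int.castRingHom ℚ)) hab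
    rcases hp.dvd_or_dvd this with h1 | h1
    · exact Or.inl (gauss_toQ _ _ hH h1)
    · exact Or.inr (gauss_toQ _ _ hH h1)

/-- The binary quadratic form with given coefficients. -/
noncomputable def quadf {R : Type*} [CommRing R] (a b c : R) : MvPolynomial (Fin 2) R :=
  C a * X 0 ^ 2 + C b * X 0 * X 1 + C c * X 1 ^ 2

lemma quadf_hom {R : Type*} [CommRing R] (a b c : R) : (quadf a b c).IsHomogeneous 2 := by
  unfold quadf
  refine ((isHomogeneous_C_mul_X_pow a 0 2).add ?_).add (isHomogeneous_C_mul_X_pow c 1 2)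
  exact (isHomogeneous_C_mul_X b 0).mul (isHomogeneous_X R 1)

lemma toQ_quadf (a b c : ℤ) : toQ (quadf a b c) = quadf (a : ℚ) b c := by simp [toQ, quadf]

lemma eval_quadf {R : Type*} [CommRing R] (a b c x y : R) :
    eval ![x, y] (quadf a b c) = a * x ^ 2 + b * (x * y) + c * y ^ 2 := by
  simp [quadf]; ring

lemma evalReal_quadf (a b c : ℤ) (x y : ℝ) :
    evalReal (quadf a b c) x y = a * x ^ 2 + b * (x * y) + c * y ^ 2 := by
  simp [quadf, evalReal]; ring

lemma quadf_prim (a b c : ℤ) (h : ∀ d : ℤ, d ∣ a → d ∣ b → d ∣ c → IsUnit d) :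
    IsPrimitiveInt (quadf a b c) := by
  intro d hd
  have h1 : C d ∣ quadf a b c := (C_dvd_iff_dvd_coeff _ _).mpr hd
  obtain ⟨K, hK⟩ := h1
  have e : ∀ x y : ℤ, d ∣ a * x ^ 2 + b * (x * y) + c * y ^ 2 := by
    intro x y
    rw [← eval_quadf, hK, map_mul, eval_C]
    exact dvd_mul_right _ _
  have ha : d ∣ a := by simpa using e 1 0
  have hc : d ∣ c := by simpa using e 0 1
  have hb : d ∣ a + b + c := by simpa using e 1 1
  have hb' : d ∣ b := by
    have := dvd_sub (dvd_sub hb ha) hc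
    ring_nf at this
    exact this
  exact h d ha hb' hc

lemma quadf_irred (a b c : ℚ) (hz : ∀ x y : ℚ, a * x ^ 2 + b * (x * y) + c * y ^ 2 = 0 →
    x = 0 ∧ y = 0) : Irreducible (quadf a b c) := by
  have hne : quadf a b c ≠ 0 := by
    intro h0
    have := eval_quadf a b c 1 0
    rw [h0, map_zero] at this
    exact one_ne_zero (hz 1 0 this.symm).1
  have htd : (quadf a b c).totalDegree = 2 := (quadf_hom a b c).totalDegree hne
  have unit0 : ∀ A : MvPolynomial (Fin 2) ℚ, A ≠ 0 → A.totalDegree = 0 → IsUnit A := by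
    intro A hA hA0
    rw [totalDegree_eq_zero_iff_eq_C] at hA0
    rw [hA0]
    apply IsUnit.map
    rw [isUnit_iff_ne_zero]
    intro h0
    apply hA; rw [hA0, h0, C_0]
  refine ⟨?_, ?_⟩
  · intro hu
    rw [MvPolynomial.isUnit_iff_totalDegree_of_isReduced] at hu
    omega
  · intro A B hAB
    have hA : A ≠ 0 := by rintro rfl; rw [zero_mul] at hAB; exact hne hAB
    have hB : B ≠ 0 := by rintro rfl; rw [mul_zero] at hAB; exact hne hAB
    have hd : A.totalDegree + B.totalDegree = 2 := by
      rw [← totalDegree_mul_of_isDomain hA hB, ← hAB, htd]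
    by_cases hA0 : A.totalDegree = 0
    · exact Or.inl (unit0 A hA hA0)
    by_cases hB0 : B.totalDegree = 0
    · exact Or.inr (unit0 B hB hB0)
    exfalso
    have hA1 : A.totalDegree = 1 := by omega
    have hsum := sum_homogeneousComponent A
    rw [hA1] at hsum
    obtain ⟨f, hf⟩ := hom_expand (homogeneousComponent 1 A) 1 (homogeneousComponent_isHomogeneous 1 A)
    simp only [Finset.sum_range_succ, Finset.range_zero, Finset.sum_empty, zero_add, pow_zero,
      mul_one, pow_one, Nat.reduceSub, Nat.sub_zero, Nat.reduceAdd, homogeneousComponent_zero]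
      at hsum hf
    set t := coeff 0 A with ht
    have hev : ∀ x y : ℚ, eval ![x, y] A = t + (f 0 * y + f 1 * x) := by
      intro x y
      rw [← hsum, hf]; simp
    have hzz : ∀ x y : ℚ, t + (f 0 * y + f 1 * x) = 0 → x = 0 ∧ y = 0 := by
      intro x y h
      apply hz
      rw [← eval_quadf, hAB, map_mul, hev, h, zero_mul]
    have h01 : f 0 ≠ 0 ∨ f 1 ≠ 0 := by
      by_contra! h
      rw [h.1, h.2] at hf
      simp only [C_0, zero_mul, add_zero] at hf
      rw [hf, add_zero] at hsum
      rw [← hsum, totalDegree_C] at hA1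
      omega
    by_cases ht0 : t = 0
    · have := hzz (f 0) (-f 1) (by rw [ht0]; ring)
      rcases h01 with h | h
      · exact h this.1
      · exact h (by simpa using this.2)
    · rcases h01 with h | h
      · have := hzz 0 (-t / f 0) (by field_simp; ring)
        have h2 := this.2
        rw [div_eq_zero_iff] at h2
        simp [ht0, h] at h2
      · have := hzz (-t / f 1) 0 (by field_simp; ring)
        have h2 := this.1
        rw [div_eq_zero_iff] at h2
        simp [ht0, h] at h2

open Polynomial in
lemma quartic_coeffs (a b c d e a' b' c' d' e' : ℚ)
    (h : Polynomial.C a * Polynomial.X ^ 4 + Polynomial.C b * Polynomial.X ^ 3 +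
    Polynomial.C c * Polynomial.X ^ 2 + Polynomial.C d * Polynomial.X + Polynomial.C e =
    Polynomial.C a' * Polynomial.X ^ 4 + Polynomial.C b' * Polynomial.X ^ 3 +
    Polynomial.C c' * Polynomial.X ^ 2 + Polynomial.C d' * Polynomial.X + Polynomial.C e') :
    a = a' ∧ b = b' ∧ c = c' ∧ d = d' ∧ e = e' := by
  have hcoef := fun n => congrArg (fun p => Polynomial.coeff p n) h
  have c4 := hcoef 4
  have c3 := hcoef 3
  have c2 := hcoef 2
  have c1 := hcoef 1
  have c0 := hcoef 0
  simp [Polynomial.coeff_X, Polynomial.coeff_C, Polynomial.coeff_X_pow] at c4 c3 c2 c1 c0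
  exact ⟨c4, c3, c2, c1, c0⟩

open Polynomial in
/-- A nonnegative rational quartic with an irrational real zero and leading coefficient `a ≠ 0`
and no rational zero is `a` times the square of a monic quadratic. -/
lemma quartic_sq (a b c d e : ℤ) (ha : a ≠ 0) (ξ : ℝ) (hξ : Irrational ξ)
    (hr : (a : ℝ) * ξ ^ 4 + b * ξ ^ 3 + c * ξ ^ 2 + d * ξ + e = 0)
    (hr' : 4 * (a : ℝ) * ξ ^ 3 + 3 * b * ξ ^ 2 + 2 * c * ξ + d = 0) :
    ∃ u w : ℚ, ξ ^ 2 + u * ξ + w = 0 ∧ (b : ℚ) = 2 * a * u ∧ (c : ℚ) = a * (u ^ 2 + 2 * w) ∧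
      (d : ℚ) = 2 * a * u * w ∧ (e : ℚ) = a * w ^ 2 := by
  set f : ℚ[X] := Polynomial.C (a : ℚ) * Polynomial.X ^ 4 + Polynomial.C (b : ℚ) * Polynomial.X ^ 3 +
    Polynomial.C (c : ℚ) * Polynomial.X ^ 2 + Polynomial.C (d : ℚ) * Polynomial.X +
    Polynomial.C (e : ℚ) with hf
  have haQ : (a : ℚ) ≠ 0 := by exact_mod_cast ha
  have hfdeg : f.natDegree = 4 := by rw [hf]; compute_degree!
  have hf0 : f ≠ 0 := by intro h; rw [h] at hfdeg; simp at hfdeg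
  have hint : IsIntegral ℚ ξ := by
    rw [← isAlgebraic_iff_isIntegral]
    refine ⟨f, hf0, ?_⟩
    simp [hf]; linarith
  set m := minpoly ℚ ξ with hm
  have hirr : Irreducible m := minpoly.irreducible hint
  have hmonic : m.Monic := minpoly.monic hint
  obtain ⟨g, hg⟩ : m ∣ f := minpoly.dvd ℚ ξ (by simp [hf]; linarith)
  have hdf : m ∣ derivative f := minpoly.dvd ℚ ξ (by simp [hf]; linarith)
  have hmdeg : 2 ≤ m.natDegree := by
    have h1 : m.natDegree ≠ 1 := by
      rw [hm, Ne, minpoly.natDegree_eq_one_iff]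
      rintro ⟨s, hs⟩
      exact hξ ⟨s, by simpa using hs⟩
    have h2 := hirr.natDegree_pos
    omega
  have hmg : m ∣ g := by
    have h1 : m ∣ derivative m * g := by
      rw [hg, derivative_mul] at hdf
      exact (dvd_add_left (dvd_mul_right _ _)).mp hdf
    rcases hirr.prime.dvd_or_dvd h1 with h2 | h2
    · exfalso
      have hd0 : derivative m ≠ 0 := by
        intro h0
        have := derivative_eq_zero.mp h0
        omega
      have h3 := natDegree_le_of_dvd h2 hd0
      have h4 := natDegree_derivative_lt (p := m) (by omega)
      omega
    · exact h2
  obtain ⟨k, hk⟩ := hmg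
  have hm0 : m ≠ 0 := hmonic.ne_zero
  have hk0 : k ≠ 0 := by rintro rfl; rw [hk] at hg; simp at hg; exact hf0 hg
  have hdeg : m.natDegree + (m.natDegree + k.natDegree) = 4 := by
    rw [← hfdeg, hg, hk, natDegree_mul hm0 (mul_ne_zero hm0 hk0), natDegree_mul hm0 hk0]
  have hmd : m.natDegree = 2 := by omega
  have hkd : k.natDegree = 0 := by omega
  obtain ⟨k0, rfl⟩ : ∃ k0, k = Polynomial.C k0 := ⟨_, eq_C_of_natDegree_eq_zero hkd⟩
  set u := m.coeff 1 with hu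
  set w := m.coeff 0 with hw
  have hmX : m = Polynomial.X ^ 2 + Polynomial.C u * Polynomial.X + Polynomial.C w := by
    have := m.as_sum_range_C_mul_X_pow
    rw [hmd] at this
    have hl : m.coeff 2 = 1 := by rw [← hmd]; exact hmonic
    simp only [Finset.sum_range_succ, Finset.range_zero, Finset.sum_empty, hl] at this
    rw [this]
    simp only [Polynomial.C_1]
    ring
  have hfe : f = Polynomial.C k0 * Polynomial.X ^ 4 + Polynomial.C (2 * k0 * u) * Polynomial.X ^ 3 +
      Polynomial.C (k0 * (u ^ 2 + 2 * w)) * Polynomial.X ^ 2 +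
      Polynomial.C (2 * k0 * u * w) * Polynomial.X + Polynomial.C (k0 * w ^ 2) := by
    rw [hg, hk, hmX]
    simp only [Polynomial.C_mul, Polynomial.C_add, Polynomial.C_pow,
      show Polynomial.C (2 : ℚ) = 2 from rfl]
    ring
  rw [hf] at hfe
  obtain ⟨c4, c3, c2, c1, c0⟩ := quartic_coeffs _ _ _ _ _ _ _ _ _ _ hfe
  refine ⟨u, w, ?_, ?_, ?_, ?_, ?_⟩
  · have := minpoly.aeval ℚ ξ
    rw [← hm, hmX] at this
    simpa using this
  · rw [c3, c4]
  · rw [c2, c4]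
  · rw [c1, c4]
  · rw [c0, c4]

lemma prim_triple (u w : ℚ) : ∃ α β γ : ℤ, α ≠ 0 ∧ (β : ℚ) = α * u ∧ (γ : ℚ) = α * w ∧
    ∀ d : ℤ, d ∣ α → d ∣ β → d ∣ γ → IsUnit d := by
  set α0 : ℤ := u.den * w.den with hα0
  set β0 : ℤ := u.num * w.den with hβ0
  set γ0 : ℤ := w.num * u.den with hγ0
  set g : ℤ := gcd α0 (gcd β0 γ0) with hg
  have hα0ne : α0 ≠ 0 := by
    rw [hα0]; exact_mod_cast mul_ne_zero u.den_nz w.den_nz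
  have hgne : g ≠ 0 := by
    intro h
    rw [hg, gcd_eq_zero_iff] at h
    exact hα0ne h.1
  obtain ⟨α, hα⟩ : g ∣ α0 := gcd_dvd_left _ _
  obtain ⟨β, hβ⟩ : g ∣ β0 := (gcd_dvd_right _ _).trans (gcd_dvd_left _ _)
  obtain ⟨γ, hγ⟩ : g ∣ γ0 := (gcd_dvd_right _ _).trans (gcd_dvd_right _ _)
  have hgQ : (g : ℚ) ≠ 0 := by exact_mod_cast hgne
  have hu := Rat.mul_den_eq_num u
  have hw := Rat.mul_den_eq_num w
  have hαQ : (u.den : ℚ) * w.den = g * α := by rw [hα0] at hα; exact_mod_cast hα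
  have hβQ : (u.num : ℚ) * w.den = g * β := by rw [hβ0] at hβ; exact_mod_cast hβ
  have hγQ : (w.num : ℚ) * u.den = g * γ := by rw [hγ0] at hγ; exact_mod_cast hγ
  refine ⟨α, β, γ, ?_, ?_, ?_, ?_⟩
  · rintro rfl; simp at hα; exact hα0ne hα
  · apply mul_left_cancel₀ hgQ
    rw [← hβQ, ← mul_assoc, ← hαQ, ← hu]; ring
  · apply mul_left_cancel₀ hgQ
    rw [← hγQ, ← mul_assoc, ← hαQ, ← hw]; ring
  · intro d h1 h2 h3
    have : g * d ∣ g := by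
      conv_rhs => rw [hg]
      refine dvd_gcd ?_ (dvd_gcd ?_ ?_)
      · rw [hα]; exact mul_dvd_mul_left _ h1
      · rw [hβ]; exact mul_dvd_mul_left _ h2
      · rw [hγ]; exact mul_dvd_mul_left _ h3
    have h4 : g * d ∣ g * 1 := by rwa [mul_one]
    exact isUnit_of_dvd_one ((mul_dvd_mul_iff_left hgne).mp h4)

set_option maxHeartbeats 2000000 in
lemma irrational_case (F1 F2 F3 F4 P0 Ft4 : MvPolynomial (Fin 2) ℤ)
    (hF1 : F1.IsHomogeneous 1) (hF2 : F2.IsHomogeneous 2) (hF3 : F3.IsHomogeneous 3)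
    (hF4 : F4.IsHomogeneous 4)
    (C' D : ℤ) (hC : 0 < C')
    (hbd : ∀ x y : ℤ, D ≤ eval ![x, y] F1 + eval ![x, y] F2 + eval ![x, y] F3 + eval ![x, y] F4)
    (hsurj : ∀ n : ℤ, D ≤ C' * n → ∃ x y : ℤ,
      eval ![x, y] F1 + eval ![x, y] F2 + eval ![x, y] F3 + eval ![x, y] F4 = C' * n)
    (hpsd : PosSemidef2 F4) (hP0 : PosDef2 P0) (hfac : F4 = P0 * Ft4)
    (hc2 : CommonFactor2 Ft4 F3)
    (hcf : ¬ CommonFactor3 Ft4 F3 F2)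
    (hm : ∀ H : MvPolynomial (Fin 2) ℤ, (∃ n, H.IsHomogeneous n) → IsPrimitiveInt H →
        Irreducible (toQ H) → H ∣ Ft4 → H ∣ F3 →
        ∀ n4 n3 : ℕ, (H ^ n4 ∣ Ft4 ∧ ¬ H ^ (n4 + 1) ∣ Ft4) →
          (H ^ n3 ∣ F3 ∧ ¬ H ^ (n3 + 1) ∣ F3) → 2 * n3 ≠ n4)
    (hint : ∀ x y : ℤ, eval ![x, y] F4 = 0 → x = 0 ∧ y = 0)
    (v₁ v₂ : ℝ) (hv : (v₁, v₂) ≠ (0, 0)) (hz : evalReal F4 v₁ v₂ = 0) : False := by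
  obtain ⟨f, hf⟩ := hom_expand F4 4 hF4
  obtain ⟨f2, hf2⟩ := hom_expand F2 2 hF2
  obtain ⟨f1, hf1⟩ := hom_expand F1 1 hF1
  simp only [Finset.sum_range_succ, Finset.range_zero, Finset.sum_empty, zero_add, pow_zero,
      mul_one, pow_one, Nat.reduceSub, Nat.sub_zero, Nat.reduceAdd] at hf hf2 hf1
  have hevR : ∀ x y : ℝ, evalReal F4 x y = f 4 * x ^ 4 + f 3 * x ^ 3 * y + f 2 * x ^ 2 * y ^ 2 +
      f 1 * x * y ^ 3 + f 0 * y ^ 4 := by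
    intro x y; rw [hf]; simp [evalReal]; ring
  have hevZ : ∀ x y : ℤ, eval ![x, y] F4 = f 4 * x ^ 4 + f 3 * x ^ 3 * y + f 2 * x ^ 2 * y ^ 2 +
      f 1 * x * y ^ 3 + f 0 * y ^ 4 := by
    intro x y; rw [hf]; simp; ring
  have ha : f 4 ≠ 0 := by
    intro h
    have := hint 1 0 (by rw [hevZ, h]; ring)
    exact one_ne_zero this.1
  have haR : (f 4 : ℝ) ≠ 0 := by exact_mod_cast ha
  have hv2 : v₂ ≠ 0 := by
    rintro rfl
    rw [hevR] at hz
    have : v₁ = 0 := by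
      have h : (f 4 : ℝ) * v₁ ^ 4 = 0 := by linear_combination hz
      rcases mul_eq_zero.mp h with h | h
      · exact absurd h haR
      · exact pow_eq_zero_iff (by norm_num) |>.mp h
    exact hv (by rw [this])
  obtain ⟨ξ, hξv⟩ : ∃ ξ : ℝ, v₁ = ξ * v₂ := ⟨v₁ / v₂, by field_simp⟩
  have hr : (f 4 : ℝ) * ξ ^ 4 + f 3 * ξ ^ 3 + f 2 * ξ ^ 2 + f 1 * ξ + f 0 = 0 := by
    rw [hevR, hξv] at hz
    have h : v₂ ^ 4 * ((f 4 : ℝ) * ξ ^ 4 + f 3 * ξ ^ 3 + f 2 * ξ ^ 2 + f 1 * ξ + f 0) = 0 := by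
      linear_combination hz
    rcases mul_eq_zero.mp h with h | h
    · exact absurd h (pow_ne_zero _ hv2)
    · exact h
  have hξ : Irrational ξ := by
    rintro ⟨s, hs⟩
    have hsd : (s : ℝ) * s.den = s.num := by exact_mod_cast Rat.mul_den_eq_num s
    have h1 : ((eval ![s.num, (s.den : ℤ)] F4 : ℤ) : ℝ) = 0 := by
      rw [hevZ]; push_cast
      rw [← hsd, hs]
      linear_combination (s.den : ℝ) ^ 4 * hr
    have h2 := (hint _ _ (by exact_mod_cast h1)).2
    exact s.den_nz (by exact_mod_cast h2)
  have hr' : 4 * (f 4 : ℝ) * ξ ^ 3 + 3 * f 3 * ξ ^ 2 + 2 * f 2 * ξ + f 1 = 0 := by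
    apply first_coeff_zero (f 4) (4 * f 4 * ξ + f 3) (6 * f 4 * ξ ^ 2 + 3 * f 3 * ξ + f 2)
    intro t
    have := hpsd (ξ + t) 1
    rw [hevR] at this
    linarith
  obtain ⟨u, w, hξuw, hb, hc, hd, he⟩ := quartic_sq (f 4) (f 3) (f 2) (f 1) (f 0) ha ξ hξ hr hr'
  obtain ⟨α, β, γ, hα, hβ, hγ, hprim⟩ := prim_triple u w
  have hroot : (α : ℝ) * ξ ^ 2 + β * ξ + γ = 0 := by
    have hβ' : (β : ℝ) = α * u := by exact_mod_cast hβ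
    have hγ' : (γ : ℝ) = α * w := by exact_mod_cast hγ
    rw [hβ', hγ']
    linear_combination (α : ℝ) * hξuw
  set Q := quadf α β γ with hQ
  have hQprim : IsPrimitiveInt Q := quadf_prim α β γ hprim
  have hQv : evalReal Q v₁ v₂ = 0 := by
    rw [hQ, evalReal_quadf, hξv]
    linear_combination v₂ ^ 2 * hroot
  have hQne : Q ≠ 0 := by
    intro h
    have := eval_quadf α β γ 1 0
    rw [← hQ, h, map_zero] at this
    apply hα; linarith
  have hscale : C (α ^ 2) * F4 = C (f 4) * (Q * Q) := by
    have e3 : α ^ 2 * f 3 = f 4 * (2 * α * β) := by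
      have : ((α ^ 2 * f 3 : ℤ) : ℚ) = ((f 4 * (2 * α * β) : ℤ) : ℚ) := by
        push_cast; rw [hb, hβ]; ring
      exact_mod_cast this
    have e2 : α ^ 2 * f 2 = f 4 * (β ^ 2 + 2 * α * γ) := by
      have : ((α ^ 2 * f 2 : ℤ) : ℚ) = ((f 4 * (β ^ 2 + 2 * α * γ) : ℤ) : ℚ) := by
        push_cast; rw [hc, hβ, hγ]; ring
      exact_mod_cast this
    have e1 : α ^ 2 * f 1 = f 4 * (2 * β * γ) := by
      have : ((α ^ 2 * f 1 : ℤ) : ℚ) = ((f 4 * (2 * β * γ) : ℤ) : ℚ) := by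
        push_cast; rw [hd, hβ, hγ]; ring
      exact_mod_cast this
    have e0 : α ^ 2 * f 0 = f 4 * γ ^ 2 := by
      have : ((α ^ 2 * f 0 : ℤ) : ℚ) = ((f 4 * γ ^ 2 : ℤ) : ℚ) := by
        push_cast; rw [he, hγ]; ring
      exact_mod_cast this
    have E3 := congrArg (C : ℤ → MvPolynomial (Fin 2) ℤ) e3
    have E2 := congrArg (C : ℤ → MvPolynomial (Fin 2) ℤ) e2
    have E1 := congrArg (C : ℤ → MvPolynomial (Fin 2) ℤ) e1
    have E0 := congrArg (C : ℤ → MvPolynomial (Fin 2) ℤ) e0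
    have two : (C (2 : ℤ) : MvPolynomial (Fin 2) ℤ) = 2 := rfl
    simp only [C_mul, C_pow, C_add, two] at E3 E2 E1 E0
    rw [hf, hQ]
    simp only [quadf, C_pow]
    linear_combination X 1 ^ 4 * E0 + X 0 * X 1 ^ 3 * E1 + X 0 ^ 2 * X 1 ^ 2 * E2 +
      X 0 ^ 3 * X 1 * E3
  have hα2 : α ^ 2 ≠ 0 := pow_ne_zero _ hα
  obtain ⟨G, hG⟩ : Q ∣ F4 := gauss_C Q hQprim _ hα2 F4 (by
    rw [hscale]; exact ⟨C (f 4) * Q, by ring⟩)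
  have hGs : C (α ^ 2) * G = C (f 4) * Q := by
    apply mul_left_cancel₀ hQne
    rw [hG] at hscale
    linear_combination hscale
  obtain ⟨K, hK⟩ : Q ∣ G := gauss_C Q hQprim _ hα2 G (by rw [hGs]; exact dvd_mul_left _ _)
  have hKs : C (α ^ 2) * K = C (f 4) := by
    apply mul_left_cancel₀ hQne
    rw [hK] at hGs
    linear_combination hGs
  obtain ⟨k, hk⟩ : ∃ k : ℤ, K = C k := by
    have hCα : (C (α ^ 2) : MvPolynomial (Fin 2) ℤ) ≠ 0 := by
      rw [Ne, C_eq_zero]; exact hα2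
    have hK0 : K ≠ 0 := by
      rintro rfl
      rw [mul_zero] at hKs
      exact ha (C_eq_zero.mp hKs.symm)
    have h1 := totalDegree_mul_of_isDomain hCα hK0
    rw [hKs, totalDegree_C, totalDegree_C, zero_add] at h1
    exact ⟨_, totalDegree_eq_zero_iff_eq_C.mp h1.symm⟩
  have hF4Q : F4 = C k * Q ^ 2 := by rw [hG, hK, hk]; ring
  have hka : α ^ 2 * k = f 4 := by
    rw [hk, ← C_mul] at hKs
    exact C_injective _ _ hKs
  have hkpos : 0 < k := by
    have h1 : (0 : ℝ) ≤ f 4 := by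
      have := hpsd 1 0
      rw [hevR] at this
      linarith
    have h2 : 0 < f 4 := lt_of_le_of_ne (by exact_mod_cast h1) (Ne.symm ha)
    rw [← hka] at h2
    exact pos_of_mul_pos_right h2 (by positivity) |> fun h => h
  have hqirr : Irreducible (toQ Q) := by
    rw [hQ, toQ_quadf]
    apply quadf_irred
    intro x y hxy
    have hx := Rat.mul_den_eq_num x
    have hy := Rat.mul_den_eq_num y
    have h1 : eval ![x.num * y.den, y.num * x.den] Q = 0 := by
      rw [hQ, eval_quadf]
      have : ((α * (x.num * y.den) ^ 2 + β * ((x.num * y.den) * (y.num * x.den)) +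
          γ * (y.num * x.den) ^ 2 : ℤ) : ℚ) = 0 := by
        push_cast
        rw [← hx, ← hy]
        linear_combination (x.den : ℚ) ^ 2 * (y.den : ℚ) ^ 2 * hxy
      exact_mod_cast this
    have h2 := hint (x.num * y.den) (y.num * x.den) (by
      rw [hF4Q, map_mul, map_pow, h1]; simp)
    have hxd : (x.den : ℤ) ≠ 0 := by exact_mod_cast x.den_nz
    have hyd : (y.den : ℤ) ≠ 0 := by exact_mod_cast y.den_nz
    constructor
    · rcases mul_eq_zero.mp h2.1 with h | h
      · exact Rat.num_eq_zero.mp h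
      · exact absurd h hyd
    · rcases mul_eq_zero.mp h2.2 with h | h
      · exact Rat.num_eq_zero.mp h
      · exact absurd h hxd
  have hQp : Prime Q := prime_of_toQ Q hQprim hqirr
  have hQP0 : ¬ Q ∣ P0 := by
    rintro ⟨R, hR⟩
    have := hP0 v₁ v₂ hv
    rw [hR, evalReal_mul, hQv, zero_mul] at this
    exact lt_irrefl _ this
  have hQ2 : Q ^ 2 ∣ Ft4 := by
    apply hQp.pow_dvd_of_dvd_mul_left 2 hQP0
    rw [← hfac, hF4Q]
    exact dvd_mul_left _ _
  have hQ3 : ¬ Q ^ (2 + 1) ∣ Ft4 := by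
    intro h
    have h1 : Q ^ 3 ∣ C k * Q ^ 2 := by
      rw [← hF4Q, hfac]; exact h.mul_left _
    obtain ⟨R, hR⟩ := h1
    have h2 : C k = Q * R := by
      apply mul_left_cancel₀ (pow_ne_zero 2 hQne)
      linear_combination hR
    have h3 := evalReal_C k v₁ v₂
    rw [h2, evalReal_mul, hQv, zero_mul] at h3
    have : k = 0 := by exact_mod_cast h3.symm
    omega
  have hQF3 : Q ∣ F3 := by
    apply gauss_toQ Q F3 hQprim
    obtain ⟨d, hd0, hd1, hd2⟩ := hc2
    have h1 : d ∣ toQ F4 := by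
      rw [hfac, toQ_mul]; exact hd1.mul_left _
    have hu : IsUnit (C (k : ℚ) : MvPolynomial (Fin 2) ℚ) := by
      apply IsUnit.map
      rw [isUnit_iff_ne_zero]
      have : k ≠ 0 := by omega
      exact_mod_cast this
    have h2 : d ∣ toQ Q ^ 2 := by
      have h3 : toQ F4 = C (k : ℚ) * toQ Q ^ 2 := by
        rw [hF4Q, toQ_mul, toQ_C, pow_two, toQ_mul, pow_two]
      rw [h3] at h1
      exact hu.dvd_mul_left.mp h1
    obtain ⟨i, hi, hass⟩ := (dvd_prime_pow hqirr.prime 2).mp h2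
    have hi0 : i ≠ 0 := by
      rintro rfl
      rw [pow_zero, associated_one_iff_isUnit, isUnit_iff_totalDegree_of_isReduced] at hass
      omega
    exact ((dvd_pow_self _ hi0).trans hass.symm.dvd).trans hd2
  have hF30 : F3 = 0 := by
    by_contra hne
    refine hm Q ⟨2, quadf_hom _ _ _⟩ hQprim hqirr ((dvd_pow_self Q two_ne_zero).trans hQ2) hQF3 2 1
      ⟨hQ2, hQ3⟩ ⟨by rwa [pow_one], ?_⟩ rfl
    intro h
    have h1 := totalDegree_le_of_dvd_of_isDomain h hne
    rw [((quadf_hom α β γ).pow (1 + 1)).totalDegree (pow_ne_zero _ hQne), hF3.totalDegree hne] at h1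
    omega
  have hnp : ¬ (α * f2 1 = β * f2 2 ∧ α * f2 0 = γ * f2 2) := by
    rintro ⟨h1, h2⟩
    have E1 := congrArg (C : ℤ → MvPolynomial (Fin 2) ℤ) h1
    have E0 := congrArg (C : ℤ → MvPolynomial (Fin 2) ℤ) h2
    simp only [C_mul] at E1 E0
    have h3 : C α * F2 = C (f2 2) * Q := by
      rw [hf2, hQ]
      simp only [quadf]
      linear_combination X 0 * X 1 * E1 + X 1 ^ 2 * E0
    have hQF2 : Q ∣ F2 := gauss_C Q hQprim α hα F2 (by rw [h3]; exact dvd_mul_left _ _)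
    have md : ∀ A : MvPolynomial (Fin 2) ℤ, Q ∣ A → toQ Q ∣ toQ A := fun A hA =>
      _root_.map_dvd (MvPolynomial.map (Int.castRingHom ℚ)) hA
    apply hcf
    refine ⟨toQ Q, ?_, md _ ((dvd_pow_self Q two_ne_zero).trans hQ2), md _ hQF3, md _ hQF2⟩
    have hne := hqirr.ne_zero
    rw [hQ, toQ_quadf] at hne ⊢
    rw [(quadf_hom (α : ℚ) β γ).totalDegree hne]
    norm_num
  have hval : ∀ x y : ℤ, eval ![x, y] F1 + eval ![x, y] F2 + eval ![x, y] F3 + eval ![x, y] F4 =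
      k * (α * x ^ 2 + β * (x * y) + γ * y ^ 2) ^ 2 +
      (f2 2 * x ^ 2 + f2 1 * (x * y) + f2 0 * y ^ 2) + (f1 1 * x + f1 0 * y) := by
    intro x y
    rw [hF30, hF4Q, map_mul, map_pow, hQ, eval_quadf, hf2, hf1]
    simp
    ring
  simp only [hval] at hbd hsurj
  exact irr_contra k α β γ (f2 2) (f2 1) (f2 0) (f1 1) (f1 0) C' D hC hkpos hα hbd hsurj hnp ξ hξ hroot

lemma posdef_case (F3 F4 P0 Ft4 : MvPolynomial (Fin 2) ℤ) (hF4 : F4.IsHomogeneous 4)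
    (hne : F4 ≠ 0) (k n : ℕ) (hk : P0.IsHomogeneous k) (hn : Ft4.IsHomogeneous n)
    (hfac : F4 = P0 * Ft4)
    (hmax : ∀ (P0' Ft4' : MvPolynomial (Fin 2) ℤ) (k' : ℕ),
      P0'.IsHomogeneous k' → PosDef2 P0' → F4 = P0' * Ft4' →
      (∃ n, Ft4'.IsHomogeneous n) → IsPrimitiveInt Ft4' → k' ≤ k)
    (hpd : PosDef2 F4) (hc2 : CommonFactor2 Ft4 F3) : False := by
  have h4 : 4 ≤ k := by
    refine hmax F4 1 4 hF4 hpd (mul_one _).symm ⟨0, isHomogeneous_one _ _⟩ ?_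
    intro d hd
    have := hd 0
    rw [coeff_zero_one] at this
    exact isUnit_of_dvd_one this
  have hP0ne : P0 ≠ 0 := by rintro rfl; rw [zero_mul] at hfac; exact hne hfac
  have hFtne : Ft4 ≠ 0 := by rintro rfl; rw [mul_zero] at hfac; exact hne hfac
  have h1 := totalDegree_mul_of_isDomain hP0ne hFtne
  rw [← hfac, hF4.totalDegree hne, hk.totalDegree hP0ne] at h1
  have h2 : Ft4.totalDegree = 0 := by omega
  obtain ⟨d, hd0, hd1, -⟩ := hc2
  have h3 : toQ Ft4 ≠ 0 := by
    intro h
    apply hFtne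
    apply toQ_inj
    rw [h]; simp [toQ]
  have h4 := totalDegree_le_of_dvd_of_isDomain hd1 h3
  have h5 : toQ Ft4 = C ((coeff 0 Ft4 : ℤ) : ℚ) := by
    conv_lhs => rw [totalDegree_eq_zero_iff_eq_C.mp h2]
    rw [toQ_C]
  rw [h5, totalDegree_C] at h4
  omega

lemma hom_eval_scale (G : MvPolynomial (Fin 2) ℤ) (hG : G.IsHomogeneous 4) (g x y : ℤ) :
    eval ![g * x, g * y] G = g ^ 4 * eval ![x, y] G := by
  obtain ⟨f, hf⟩ := hom_expand G 4 hG
  rw [hf]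
  simp only [Finset.sum_range_succ, Finset.range_zero, Finset.sum_empty, zero_add, pow_zero,
      mul_one, pow_one, Nat.reduceSub, Nat.sub_zero, Nat.reduceAdd]
  simp
  ring

/-- **Proposition 1.5.** Let `F ∈ ℤ[x,y]` be of degree 4 with `F(0,0) = 0`
which is linked.  If for every irreducible primitive integral form `H` dividing
`gcd(F̃₄, F₃)` the multiplicities `n₄(H)`, `n₃(H)` of `H` in `F̃₄` resp. `F₃` satisfy
`n₃(H) ≠ n₄(H)/2`, then `F(ℤ²) ≠ (Cℤ)_{≥D}` for every `C ∈ ℕ`, `D ∈ ℤ`. -/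
theorem linked_unbalanced_multiplicity_value_set_ne
    (F : MvPolynomial (Fin 2) ℤ) (hdeg : F.totalDegree = 4)
    (h0 : MvPolynomial.eval ![0, 0] F = 0) (hl : Linked F)
    (hmult : ∀ Ft4 : MvPolynomial (Fin 2) ℤ,
      IsTildePart (MvPolynomial.homogeneousComponent 4 F) Ft4 →
      ∀ H : MvPolynomial (Fin 2) ℤ, (∃ n, H.IsHomogeneous n) → IsPrimitiveInt H →
        Irreducible (toQ H) → H ∣ Ft4 → H ∣ MvPolynomial.homogeneousComponent 3 F →
        ∀ n4 n3 : ℕ,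
          (H ^ n4 ∣ Ft4 ∧ ¬ H ^ (n4 + 1) ∣ Ft4) →
          (H ^ n3 ∣ MvPolynomial.homogeneousComponent 3 F ∧
            ¬ H ^ (n3 + 1) ∣ MvPolynomial.homogeneousComponent 3 F) →
          2 * n3 ≠ n4)
    (C : ℤ) (hC : 0 < C) (D : ℤ) :
    valueSet F ≠ targetSet C D := by
  intro hEq
  obtain ⟨hpsd, Ft4, hT, hc2, hc3⟩ := hl
  have hm := hmult Ft4 hT
  obtain ⟨P0, k, hk, hP0, hfac, ⟨n, hn⟩, hprim, hmax⟩ := hT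
  have hF1 := homogeneousComponent_isHomogeneous 1 F
  have hF2 := homogeneousComponent_isHomogeneous 2 F
  have hF3 := homogeneousComponent_isHomogeneous 3 F
  have hF4 := homogeneousComponent_isHomogeneous 4 F
  have hsum := sum_homogeneousComponent F
  rw [hdeg] at hsum
  set F1 := homogeneousComponent 1 F with hF1d
  set F2 := homogeneousComponent 2 F with hF2d
  set F3 := homogeneousComponent 3 F with hF3d
  set F4 := homogeneousComponent 4 F with hF4d
  have hc0 : coeff 0 F = 0 := by
    have h1 : (![0, 0] : Fin 2 → ℤ) = 0 := by
      ext i; fin_cases i <;> rfl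
    rw [h1, MvPolynomial.eval_zero, constantCoeff_eq] at h0
    exact h0
  simp only [Finset.sum_range_succ, Finset.range_zero, Finset.sum_empty, zero_add,
    homogeneousComponent_zero, hc0, C_0, Nat.reduceAdd] at hsum
  have hev : ∀ x y : ℤ, eval ![x, y] F =
      eval ![x, y] F1 + eval ![x, y] F2 + eval ![x, y] F3 + eval ![x, y] F4 := by
    intro x y
    conv_lhs => rw [← hsum]
    simp only [map_add]
    rfl
  have hbd : ∀ x y : ℤ, D ≤ eval ![x, y] F1 + eval ![x, y] F2 + eval ![x, y] F3 +
      eval ![x, y] F4 := by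
    intro x y
    have h1 : eval ![x, y] F ∈ valueSet F := ⟨x, y, rfl⟩
    rw [hEq] at h1
    rw [← hev]
    exact h1.2
  have hsurj : ∀ n : ℤ, D ≤ C * n → ∃ x y : ℤ,
      eval ![x, y] F1 + eval ![x, y] F2 + eval ![x, y] F3 + eval ![x, y] F4 = C * n := by
    intro n hn
    have h1 : C * n ∈ targetSet C D := ⟨⟨n, rfl⟩, hn⟩
    rw [← hEq] at h1
    obtain ⟨x, y, hxy⟩ := h1
    exact ⟨x, y, by rw [← hev, hxy]⟩
  have hne : F4 ≠ 0 := by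
    rw [hfac]
    apply mul_ne_zero
    · rintro rfl
      have := hP0 1 0 (by simp)
      rw [evalReal_zero] at this
      exact lt_irrefl _ this
    · rintro rfl
      have := hprim 0 (by simp)
      simp at this
  by_cases hint : ∀ x y : ℤ, eval ![x, y] F4 = 0 → x = 0 ∧ y = 0
  · by_cases hreal : ∃ v₁ v₂ : ℝ, (v₁, v₂) ≠ (0, 0) ∧ evalReal F4 v₁ v₂ = 0
    · obtain ⟨v₁, v₂, hv, hz⟩ := hreal
      exact irrational_case F1 F2 F3 F4 P0 Ft4 hF1 hF2 hF3 hF4 C D hC hbd hsurj hpsd hP0 hfac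
        hc2 hc3 hm hint v₁ v₂ hv hz
    · refine posdef_case F3 F4 P0 Ft4 hF4 hne k n hk hn hfac hmax ?_ hc2
      intro x y hxy
      refine lt_of_le_of_ne (hpsd x y) ?_
      intro h
      exact hreal ⟨x, y, hxy, h.symm⟩
  · push Not at hint
    obtain ⟨x, y, hxy, hxy0⟩ := hint
    have hg : 0 < Int.gcd x y := by
      rw [Int.gcd_pos_iff]
      by_cases hx : x = 0
      · exact Or.inr (hxy0 hx)
      · exact Or.inl hx
    obtain ⟨t₁, t₂, hco, hx, hy⟩ := Int.exists_gcd_one hg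
    have hgne : ((Int.gcd x y : ℕ) : ℤ) ≠ 0 := by exact_mod_cast hg.ne'
    have hz : eval ![t₁, t₂] F4 = 0 := by
      have := hom_eval_scale F4 hF4 (Int.gcd x y) t₁ t₂
      rw [mul_comm _ t₁, mul_comm _ t₂, ← hx, ← hy, hxy] at this
      rcases mul_eq_zero.mp this.symm with h | h
      · exact absurd h (pow_ne_zero _ hgne)
      · exact h
    have hbez := Int.gcd_eq_gcd_ab t₁ t₂
    rw [hco] at hbez
    refine rational_case F1 F2 F3 F4 P0 Ft4 hF1 hF2 hF3 hF4 hne C D hC hbd hsurj hpsd hP0 hfac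
        hc3 hm (Int.gcdB t₁ t₂) (-Int.gcdA t₁ t₂) t₁ t₂ ?_ hz
    push_cast at hbez
    linarith
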